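/- arXiv:1102.2157 — 6 statements merged into one kernel-verified Lean document; each statement's English description precedes it below -/
import Mathlib

section
/- For every σ > 3/2 there exists a constant C > 0 such that for every measurable f : ℝ → ℂ, (∫_ℝ (1+x²)^{−σ} (∫_ℝ |x−y| |f(y)| dy)² dx)^{1/2} ≤ C (∫_ℝ (1+y²)^{σ} |f(y)|² dy)^{1/2}; that is, the integral operator with kernel |x−y| is bounded from L²_σ(ℝ) to L²_{−σ}(ℝ). -/
open MeasureTheory
open scoped ENNReal NNReal

theorem lintegral_one_add_sq_rpow_lt_top {s : ℝ} (hs : s < -(1 / 2)) :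
    ∫⁻ x : ℝ, ENNReal.ofReal ((1 + x ^ 2) ^ s) < ∞ := by
  have h : Integrable (fun x : ℝ ↦ ((1 : ℝ) + ‖x‖ ^ 2) ^ (-(-2 * s) / 2)) :=
    integrable_rpow_neg_one_add_norm_sq (by simp; linarith)
  have e : (fun x : ℝ ↦ ((1 : ℝ) + ‖x‖ ^ 2) ^ (-(-2 * s) / 2)) = fun x ↦ (1 + x ^ 2) ^ s := by
    funext x
    rw [Real.norm_eq_abs, sq_abs]
    congr 1
    ring
  rw [e] at h
  exact h.lintegral_lt_top

theorem abs_sub_le_rpow_mul_rpow (x y : ℝ) :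
    |x - y| ≤ (1 + x ^ 2) ^ (1 / 2 : ℝ) * (1 + y ^ 2) ^ (1 / 2 : ℝ) := by
  rw [← Real.mul_rpow (by positivity) (by positivity), ← Real.sqrt_eq_rpow]
  exact Real.abs_le_sqrt (by nlinarith [sq_nonneg (1 + x * y)])

/-- The Cauchy–Schwarz bound for the integral of `(1+y²)^{1/2} |f(y)|` against the weight
`(1+y²)^σ`. -/
theorem lintegral_weight_mul_sq_le (σ : ℝ) {f : ℝ → ℂ} (hf : Measurable f) :
    (∫⁻ y : ℝ, ENNReal.ofReal ((1 + y ^ 2) ^ (1 / 2 : ℝ)) * ‖f y‖₊) ^ 2 ≤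
      (∫⁻ y : ℝ, ENNReal.ofReal ((1 + y ^ 2) ^ (1 - σ))) *
        ∫⁻ y : ℝ, ENNReal.ofReal ((1 + y ^ 2) ^ σ) * (‖f y‖₊ : ℝ≥0∞) ^ 2 := by
  have h := ENNReal.lintegral_mul_le_Lp_mul_Lq volume Real.HolderConjugate.two_two
    (f := fun y : ℝ ↦ ENNReal.ofReal ((1 + y ^ 2) ^ ((1 - σ) / 2)))
    (g := fun y : ℝ ↦ ENNReal.ofReal ((1 + y ^ 2) ^ (σ / 2)) * ‖f y‖₊)
    (by fun_prop) (by fun_prop)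
  have sq_weight (a y : ℝ) : ENNReal.ofReal ((1 + y ^ 2) ^ (a / 2)) ^ 2 =
      ENNReal.ofReal ((1 + y ^ 2) ^ a) := by
    rw [← ENNReal.ofReal_pow (by positivity), ← Real.rpow_mul_natCast (by positivity)]
    congr 2
    push_cast
    ring
  have prod_weight (y : ℝ) : ENNReal.ofReal ((1 + y ^ 2) ^ ((1 - σ) / 2)) *
      ENNReal.ofReal ((1 + y ^ 2) ^ (σ / 2)) = ENNReal.ofReal ((1 + y ^ 2) ^ (1 / 2 : ℝ)) := by
    rw [← ENNReal.ofReal_mul (by positivity), ← Real.rpow_add (by positivity)]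
    congr 2
    ring
  simp only [Pi.mul_apply, ENNReal.rpow_two, mul_pow, sq_weight, ← mul_assoc, prod_weight] at h
  refine (pow_le_pow_left₀ zero_le h 2).trans_eq ?_
  rw [mul_pow, ← ENNReal.rpow_mul_natCast, ← ENNReal.rpow_mul_natCast]
  norm_num

/-- The integral operator with kernel `|x−y|` is bounded from `L²_σ(ℝ)` to `L²_{−σ}(ℝ)`
for every `σ > 3/2`:
`(∫ (1+x²)^{−σ} (∫ |x−y||f(y)|dy)² dx)^{1/2} ≤ C (∫ (1+y²)^σ |f(y)|² dy)^{1/2}`. -/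
theorem kernel_abs_weighted_bound (σ : ℝ) (hσ : 3 / 2 < σ) :
    ∃ C : ℝ, 0 < C ∧ ∀ f : ℝ → ℂ, Measurable f →
      (∫⁻ x : ℝ, ENNReal.ofReal ((1 + x ^ 2) ^ (-σ)) *
          (∫⁻ y : ℝ, ENNReal.ofReal |x - y| * ‖f y‖₊) ^ 2) ^ (1 / 2 : ℝ)
        ≤ ENNReal.ofReal C *
          (∫⁻ y : ℝ, ENNReal.ofReal ((1 + y ^ 2) ^ σ) * (‖f y‖₊ : ℝ≥0∞) ^ 2) ^ (1 / 2 : ℝ) := by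
  have hI := lintegral_one_add_sq_rpow_lt_top (s := 1 - σ) (by linarith)
  set I := ∫⁻ x : ℝ, ENNReal.ofReal ((1 + x ^ 2) ^ (1 - σ)) with hIdef
  refine ⟨I.toReal + 1, by positivity, fun f hf ↦ ?_⟩
  have hJ := lintegral_weight_mul_sq_le σ hf
  rw [← hIdef] at hJ
  set N := ∫⁻ y : ℝ, ENNReal.ofReal ((1 + y ^ 2) ^ σ) * (‖f y‖₊ : ℝ≥0∞) ^ 2
  set J := ∫⁻ y : ℝ, ENNReal.ofReal ((1 + y ^ 2) ^ (1 / 2 : ℝ)) * ‖f y‖₊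
  have inner_le (x : ℝ) : ∫⁻ y : ℝ, ENNReal.ofReal |x - y| * ‖f y‖₊ ≤
      ENNReal.ofReal ((1 + x ^ 2) ^ (1 / 2 : ℝ)) * J := by
    rw [← lintegral_const_mul _ (by fun_prop)]
    refine lintegral_mono fun y ↦ ?_
    rw [← mul_assoc, ← ENNReal.ofReal_mul (by positivity)]
    gcongr
    exact abs_sub_le_rpow_mul_rpow x y
  have weight_eq (x : ℝ) : ENNReal.ofReal ((1 + x ^ 2) ^ (-σ)) *
      ENNReal.ofReal ((1 + x ^ 2) ^ (1 / 2 : ℝ)) ^ 2 = ENNReal.ofReal ((1 + x ^ 2) ^ (1 - σ)) := by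
    rw [← ENNReal.ofReal_pow (by positivity), ← Real.rpow_mul_natCast (by positivity),
      ← ENNReal.ofReal_mul (by positivity), ← Real.rpow_add (by positivity)]
    congr 2
    push_cast
    ring
  have outer_le : ∫⁻ x : ℝ, ENNReal.ofReal ((1 + x ^ 2) ^ (-σ)) *
      (∫⁻ y : ℝ, ENNReal.ofReal |x - y| * ‖f y‖₊) ^ 2 ≤ I ^ 2 * N :=
    calc
      _ ≤ ∫⁻ x : ℝ, ENNReal.ofReal ((1 + x ^ 2) ^ (1 - σ)) * J ^ 2 := by
        refine lintegral_mono fun x ↦ ?_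
        rw [← weight_eq, mul_assoc, ← mul_pow]
        gcongr
        exact inner_le x
      _ = I * J ^ 2 := lintegral_mul_const _ (by fun_prop)
      _ ≤ I * (I * N) := by gcongr
      _ = I ^ 2 * N := by ring
  calc
    _ ≤ (I ^ 2 * N) ^ (1 / 2 : ℝ) := by gcongr
    _ = I * N ^ (1 / 2 : ℝ) := by
      rw [ENNReal.mul_rpow_of_nonneg _ _ (by norm_num), ← ENNReal.rpow_natCast_mul]
      norm_num
    _ ≤ ENNReal.ofReal (I.toReal + 1) * N ^ (1 / 2 : ℝ) := by
      gcongr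
      exact ENNReal.le_ofReal_iff_toReal_le hI.ne (by positivity) |>.2 (by linarith)
end

section
/- For every σ > 1/2 there exists a constant C > 0 such that for every ζ ∈ ℂ \ [0,∞) with |ζ| ≥ 1, with k ∈ ℂ the square root of ζ with Im k > 0, the integral operator with kernel −e^{ik|x−y|}/(2ik) is bounded from L²_σ(ℝ) to L²_{−σ}(ℝ) with operator norm at most C|ζ|^{−1/2}. -/
noncomputable section

open MeasureTheory
open scoped ENNReal NNReal

/-- Integrability of the weight `(1 + x²)^(-σ)` for `σ > 1/2`. -/
theorem lintegral_ofReal_one_add_sq_rpow_neg_lt_top {σ : ℝ} (hσ : 1 / 2 < σ) :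
    ∫⁻ x : ℝ, ENNReal.ofReal ((1 + x ^ 2) ^ (-σ)) < ∞ := by
  have h := integrable_rpow_neg_one_add_norm_sq (E := ℝ) (μ := volume) (r := 2 * σ)
    (by simp only [Module.finrank_self, Nat.cast_one]; linarith)
  have h' : Integrable (fun x : ℝ => (1 + x ^ 2) ^ (-σ)) := by
    refine h.congr (ae_of_all _ fun x => ?_)
    simp only [Real.norm_eq_abs, sq_abs]
    congr 1
    ring
  exact h'.lintegral_lt_top

theorem measurable_ofReal_one_add_sq_rpow (s : ℝ) :
    Measurable fun y : ℝ => ENNReal.ofReal ((1 + y ^ 2) ^ s) :=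
  (((measurable_id.pow_const 2).const_add 1).pow_const s).ennreal_ofReal

/-- Cauchy–Schwarz: weighted `L²` functions are controlled in `L¹`. -/
theorem lintegral_enorm_le_weighted (σ : ℝ) {f : ℝ → ℂ} (hf : Measurable f) :
    ∫⁻ y : ℝ, ‖f y‖ₑ ≤
      (∫⁻ y : ℝ, ENNReal.ofReal ((1 + y ^ 2) ^ (-σ))) ^ (1 / 2 : ℝ) *
        (∫⁻ y : ℝ, ENNReal.ofReal ((1 + y ^ 2) ^ σ) * ‖f y‖ₑ ^ 2) ^ (1 / 2 : ℝ) := by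
  have hpos : ∀ y : ℝ, 0 < 1 + y ^ 2 := fun y => by positivity
  have hmeas := measurable_ofReal_one_add_sq_rpow
  have hsq : ∀ s y : ℝ, ENNReal.ofReal ((1 + y ^ 2) ^ (s / 2)) ^ 2 =
      ENNReal.ofReal ((1 + y ^ 2) ^ s) := fun s y => by
    rw [← ENNReal.ofReal_pow (Real.rpow_nonneg (hpos y).le _), ← Real.rpow_natCast,
      ← Real.rpow_mul (hpos y).le]
    congr 2
    push_cast
    ring
  have hH := ENNReal.lintegral_mul_le_Lp_mul_Lq volume Real.HolderConjugate.two_two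
    (hmeas (-σ / 2)).aemeasurable ((hmeas (σ / 2)).mul hf.enorm).aemeasurable
  simp only [ENNReal.rpow_two, Pi.mul_apply, mul_pow, hsq] at hH
  refine le_trans (le_of_eq (lintegral_congr fun y => ?_)) hH
  rw [← mul_assoc, ← ENNReal.ofReal_mul (Real.rpow_nonneg (hpos y).le _),
    ← Real.rpow_add (hpos y), neg_div, neg_add_cancel, Real.rpow_zero, ENNReal.ofReal_one, one_mul]

/-- The free resolvent kernel is bounded by `‖k‖⁻¹` in the upper half plane. -/
theorem norm_free_resolvent_kernel_le {k : ℂ} (hk : 0 < k.im) {t : ℝ} (ht : 0 ≤ t) :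
    ‖-(Complex.exp (Complex.I * k * (t : ℝ))) / (2 * Complex.I * k)‖ ≤ ‖k‖⁻¹ := by
  have hk0 : 0 < ‖k‖ := norm_pos_iff.2 fun h => by simp [h] at hk
  have he : ‖Complex.exp (Complex.I * k * (t : ℝ))‖ ≤ 1 := by
    rw [Complex.norm_exp, Real.exp_le_one_iff]
    simpa using mul_nonneg hk.le ht
  rw [norm_div, norm_neg, norm_mul, norm_mul, Complex.norm_I, mul_one, Complex.norm_two,
    div_le_iff₀ (by positivity)]
  have : ‖k‖⁻¹ * (2 * ‖k‖) = 2 := by field_simp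
  linarith

/-- High-energy bound for the free 1D Schrödinger resolvent: for `σ > 1/2`, the integral
operator with kernel `−e^{ik|x−y|}/(2ik)` (where `k² = ζ`, `Im k > 0`, `ζ ∉ [0,∞)`,
`|ζ| ≥ 1`) is bounded from `L²_σ` to `L²_{−σ}` with operator norm at most `C|ζ|^{−1/2}`. -/
theorem free_resolvent_high_energy_bound (σ : ℝ) (hσ : 1 / 2 < σ) :
    ∃ C : ℝ, 0 < C ∧ ∀ ζ k : ℂ,
      (∀ r : ℝ, 0 ≤ r → ζ ≠ (r : ℂ)) → 1 ≤ ‖ζ‖ → k ^ 2 = ζ → 0 < k.im →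
      ∀ f : ℝ → ℂ, Measurable f →
        (∫⁻ x : ℝ, ENNReal.ofReal ((1 + x ^ 2) ^ (-σ)) *
            (‖∫ y : ℝ, (-(Complex.exp (Complex.I * k * (|x - y| : ℝ)))
                / (2 * Complex.I * k)) * f y‖₊ : ℝ≥0∞) ^ 2) ^ (1 / 2 : ℝ)
          ≤ ENNReal.ofReal (C * ‖ζ‖ ^ (-(1 / 2) : ℝ)) *
            (∫⁻ y : ℝ, ENNReal.ofReal ((1 + y ^ 2) ^ σ) * (‖f y‖₊ : ℝ≥0∞) ^ 2) ^ (1 / 2 : ℝ) := by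
  set A : ℝ≥0∞ := ∫⁻ x : ℝ, ENNReal.ofReal ((1 + x ^ 2) ^ (-σ))
  have hAtop : A ≠ ∞ := (lintegral_ofReal_one_add_sq_rpow_neg_lt_top hσ).ne
  refine ⟨A.toReal + 1, by positivity, fun ζ k _ _ hkζ hk f hf => ?_⟩
  change (∫⁻ x : ℝ, ENNReal.ofReal ((1 + x ^ 2) ^ (-σ)) * ‖∫ y : ℝ, (_ : ℂ)‖ₑ ^ 2) ^ (1 / 2 : ℝ) ≤
    _ * (∫⁻ y : ℝ, ENNReal.ofReal ((1 + y ^ 2) ^ σ) * ‖f y‖ₑ ^ 2) ^ (1 / 2 : ℝ)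
  set N : ℝ≥0∞ := (∫⁻ y : ℝ, ENNReal.ofReal ((1 + y ^ 2) ^ σ) * ‖f y‖ₑ ^ 2) ^ (1 / 2 : ℝ)
  have hζ : ‖ζ‖ ^ (-(1 / 2) : ℝ) = ‖k‖⁻¹ := by
    rw [← hkζ, norm_pow, ← Real.rpow_natCast, ← Real.rpow_mul (norm_nonneg k),
      ← Real.rpow_neg_one]
    norm_num
  have hpt : ∀ x : ℝ, ‖∫ y : ℝ, (-(Complex.exp (Complex.I * k * (|x - y| : ℝ)))
      / (2 * Complex.I * k)) * f y‖ₑ ≤ ENNReal.ofReal ‖k‖⁻¹ * (A ^ (1 / 2 : ℝ) * N) := fun x => by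
    refine (enorm_integral_le_lintegral_enorm _).trans ?_
    calc _ ≤ ∫⁻ y : ℝ, ENNReal.ofReal ‖k‖⁻¹ * ‖f y‖ₑ := by
          refine lintegral_mono fun y => ?_
          rw [enorm_mul, ← ofReal_norm]
          gcongr
          exact norm_free_resolvent_kernel_le hk (abs_nonneg _)
      _ = ENNReal.ofReal ‖k‖⁻¹ * ∫⁻ y : ℝ, ‖f y‖ₑ := lintegral_const_mul _ hf.enorm
      _ ≤ _ := by
          gcongr
          exact lintegral_enorm_le_weighted σ hf
  have hsqrt : ∀ a : ℝ≥0∞, (a ^ 2) ^ (1 / 2 : ℝ) = a := fun a => by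
    rw [← ENNReal.rpow_natCast, ← ENNReal.rpow_mul]
    norm_num
  calc _ ≤ (∫⁻ x : ℝ, ENNReal.ofReal ((1 + x ^ 2) ^ (-σ)) *
        (ENNReal.ofReal ‖k‖⁻¹ * (A ^ (1 / 2 : ℝ) * N)) ^ 2) ^ (1 / 2 : ℝ) := by
        gcongr with x
        exact hpt x
    _ = A ^ (1 / 2 : ℝ) * (ENNReal.ofReal ‖k‖⁻¹ * (A ^ (1 / 2 : ℝ) * N)) := by
        rw [lintegral_mul_const _ (measurable_ofReal_one_add_sq_rpow (-σ)),
          ENNReal.mul_rpow_of_nonneg _ _ (by norm_num), hsqrt]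
    _ = A ^ (1 / 2 + 1 / 2 : ℝ) * ENNReal.ofReal ‖k‖⁻¹ * N := by
        rw [ENNReal.rpow_add_of_nonneg _ _ (by norm_num) (by norm_num)]
        ring
    _ ≤ _ := by
        rw [hζ, ENNReal.ofReal_mul (by positivity), add_halves, ENNReal.rpow_one]
        gcongr
        rw [← ENNReal.ofReal_toReal hAtop]
        exact ENNReal.ofReal_le_ofReal (by simp)
end
end

section
/- Fix σ > 1/2 and r > 0. For ζ > 0 and ε ≥ 0, let R₀(ζ + iε) denote the integral operator with kernel −e^{ik|x−y|}/(2ik), where k is the square root of ζ + iε with Im k > 0 when ε > 0 and k = √ζ > 0 when ε = 0. Then sup_{ζ ≥ r} ‖R₀(ζ + iε) − R₀(ζ + i0)‖_{L(L²_σ, L²_{−σ})} → 0 as ε → 0+; that is, the limiting absorption principle R₀(ζ + iε) → R₀(ζ + i0) holds in the weighted operator norm, uniformly in ζ ≥ r. -/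
noncomputable section

open MeasureTheory
open scoped ENNReal NNReal

lemma norm_exp_I_mul_sub_le {a b : ℂ} (ha : 0 ≤ a.im) (hb : 0 ≤ b.im) {t : ℝ} (ht : 0 ≤ t) :
    ‖Complex.exp (Complex.I * a * t) - Complex.exp (Complex.I * b * t)‖ ≤ ‖a - b‖ * t := by
  have h := (convex_halfSpace_re_le 0).norm_image_sub_le_of_norm_hasDerivWithin_le
    (f := Complex.exp) (f' := Complex.exp) (C := 1)
    (x := Complex.I * b * t) (y := Complex.I * a * t)
    (fun z _ => (Complex.hasDerivAt_exp z).hasDerivWithinAt)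
    (fun z hz => by
      rw [Complex.norm_exp]
      exact Real.exp_le_one_iff.2 hz)
    (by simpa using mul_nonneg hb ht) (by simpa using mul_nonneg ha ht)
  refine h.trans_eq ?_
  have : Complex.I * a * t - Complex.I * b * t = Complex.I * (a - b) * t := by ring
  rw [this]
  simp [abs_of_nonneg ht]

lemma norm_exp_I_mul_le_one {a : ℂ} (ha : 0 ≤ a.im) {t : ℝ} (ht : 0 ≤ t) :
    ‖Complex.exp (Complex.I * a * t)‖ ≤ 1 := by
  rw [Complex.norm_exp, Real.exp_le_one_iff]
  simpa using mul_nonneg ha ht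

lemma norm_exp_I_mul_sub_le_rpow {a b : ℂ} (ha : 0 ≤ a.im) (hb : 0 ≤ b.im) {t : ℝ} (ht : 0 ≤ t)
    {θ : ℝ} (hθ : 0 ≤ θ) (hθ1 : θ ≤ 1) :
    ‖Complex.exp (Complex.I * a * t) - Complex.exp (Complex.I * b * t)‖
      ≤ 2 * (‖a - b‖ * t) ^ θ := by
  have hs : 0 ≤ ‖a - b‖ * t := by positivity
  rcases le_total (‖a - b‖ * t) 1 with h | h
  · have h1 := Real.rpow_le_rpow_of_exponent_ge_of_imp hs h hθ1 (fun _ h' => by linarith)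
    rw [Real.rpow_one] at h1
    linarith [norm_exp_I_mul_sub_le ha hb ht]
  · have h1 := Real.one_le_rpow h hθ
    linarith [norm_sub_le (Complex.exp (Complex.I * a * t)) (Complex.exp (Complex.I * b * t)),
      norm_exp_I_mul_le_one ha ht, norm_exp_I_mul_le_one hb ht]

lemma one_add_sq_sub_rpow_le (x y : ℝ) {s : ℝ} (hs : 0 ≤ s) (hs1 : s ≤ 1) :
    (1 + |x - y| ^ 2) ^ s ≤ 2 * ((1 + x ^ 2) ^ s * (1 + y ^ 2) ^ s) := by
  have h : 1 + |x - y| ^ 2 ≤ 2 * ((1 + x ^ 2) * (1 + y ^ 2)) := by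
    rw [sq_abs]
    nlinarith [sq_nonneg (x + y), sq_nonneg (x * y)]
  refine (Real.rpow_le_rpow (by positivity) h hs).trans ?_
  rw [Real.mul_rpow (by positivity) (by positivity), Real.mul_rpow (by positivity) (by positivity)]
  gcongr
  simpa using Real.rpow_le_rpow_of_exponent_le (one_le_two : (1 : ℝ) ≤ 2) hs1

/-- The kernel of the free resolvent at the square root `k` of the spectral parameter. -/
def freeResolventKernel (k : ℂ) (x y : ℝ) : ℂ :=
  -(Complex.exp (Complex.I * k * (|x - y| : ℝ))) / (2 * Complex.I * k)

lemma measurable_freeResolventKernel (k : ℂ) (x : ℝ) : Measurable (freeResolventKernel k x) := by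
  unfold freeResolventKernel
  fun_prop

lemma norm_freeResolventKernel_le {k : ℂ} (hk : 0 ≤ k.im) (x y : ℝ) :
    ‖freeResolventKernel k x y‖ ≤ 1 / (2 * ‖k‖) := by
  unfold freeResolventKernel
  rw [norm_div, norm_neg]
  simp only [norm_mul, Complex.norm_I, mul_one, Complex.norm_ofNat]
  gcongr
  exact norm_exp_I_mul_le_one hk (abs_nonneg _)

lemma norm_freeResolventKernel_sub_le {a b : ℂ} (ha : 0 ≤ a.im) (hb : 0 ≤ b.im) {R δ θ : ℝ}
    (hR : 0 < R) (haR : R ≤ ‖a‖) (hbR : R ≤ ‖b‖) (hab : ‖a - b‖ ≤ δ) (hδ : δ ≤ 1)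
    (hθ : 0 ≤ θ) (hθ1 : θ ≤ 1) (x y : ℝ) :
    ‖freeResolventKernel a x y - freeResolventKernel b x y‖
      ≤ 2 * (1 / R + 1 / (2 * R ^ 2)) * δ ^ θ
        * ((1 + x ^ 2) ^ (θ / 2) * (1 + y ^ 2) ^ (θ / 2)) := by
  have ha0 : a ≠ 0 := norm_pos_iff.1 (hR.trans_le haR)
  have hb0 : b ≠ 0 := norm_pos_iff.1 (hR.trans_le hbR)
  have hδ0 : 0 ≤ δ := (norm_nonneg _).trans hab
  unfold freeResolventKernel
  set t := |x - y| with ht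
  have ht0 : 0 ≤ t := abs_nonneg _
  set u := Complex.exp (Complex.I * a * t) with hu
  set v := Complex.exp (Complex.I * b * t) with hv
  have hsplit : -u / (2 * Complex.I * a) - -v / (2 * Complex.I * b)
      = (v - u) / (2 * Complex.I * a) + v * (a - b) / (2 * Complex.I * (a * b)) := by
    field_simp
    ring
  have h1 : ‖(v - u) / (2 * Complex.I * a)‖ ≤ 1 / R * (δ ^ θ * (1 + t ^ 2) ^ (θ / 2)) := by
    have hvu : ‖v - u‖ ≤ 2 * (δ ^ θ * (1 + t ^ 2) ^ (θ / 2)) := by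
      rw [norm_sub_rev]
      refine (norm_exp_I_mul_sub_le_rpow ha hb ht0 hθ hθ1).trans ?_
      rw [Real.mul_rpow (norm_nonneg _) ht0]
      have h3 : t ^ θ ≤ (1 + t ^ 2) ^ (θ / 2) := by
        have : t ^ θ = (t ^ 2) ^ (θ / 2) := by
          rw [← Real.rpow_natCast, ← Real.rpow_mul ht0]
          congr 1
          push_cast
          ring
        rw [this]
        gcongr
        linarith
      gcongr
    rw [norm_div]
    simp only [norm_mul, Complex.norm_I, mul_one, Complex.norm_ofNat]
    calc ‖v - u‖ / (2 * ‖a‖) ≤ 2 * (δ ^ θ * (1 + t ^ 2) ^ (θ / 2)) / (2 * R) := by gcongr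
      _ = _ := by field_simp
  have h2 : ‖v * (a - b) / (2 * Complex.I * (a * b))‖
      ≤ 1 / (2 * R ^ 2) * (δ ^ θ * (1 + t ^ 2) ^ (θ / 2)) := by
    have hv1 : ‖v‖ ≤ 1 := norm_exp_I_mul_le_one hb ht0
    have h3 : δ ≤ δ ^ θ := by
      simpa using Real.rpow_le_rpow_of_exponent_ge_of_imp hδ0 hδ hθ1 (fun _ h' => by linarith)
    have h4 : 1 ≤ (1 + t ^ 2) ^ (θ / 2) :=
      Real.one_le_rpow (by nlinarith) (by linarith)
    have h5 : δ ≤ δ ^ θ * (1 + t ^ 2) ^ (θ / 2) :=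
      h3.trans (le_mul_of_one_le_right (by positivity) h4)
    rw [norm_div]
    simp only [norm_mul, Complex.norm_I, mul_one, Complex.norm_ofNat]
    calc ‖v‖ * ‖a - b‖ / (2 * (‖a‖ * ‖b‖))
        ≤ 1 * (δ ^ θ * (1 + t ^ 2) ^ (θ / 2)) / (2 * (R * R)) := by
          gcongr
          exact hab.trans h5
      _ = _ := by field_simp
  rw [hsplit]
  calc _ ≤ (1 / R + 1 / (2 * R ^ 2)) * δ ^ θ * (1 + t ^ 2) ^ (θ / 2) := by
        refine (norm_add_le _ _).trans ((add_le_add h1 h2).trans_eq (by ring))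
    _ ≤ (1 / R + 1 / (2 * R ^ 2)) * δ ^ θ
          * (2 * ((1 + x ^ 2) ^ (θ / 2) * (1 + y ^ 2) ^ (θ / 2))) := by
        gcongr
        exact one_add_sq_sub_rpow_le x y (by linarith) (by linarith)
    _ = _ := by ring

lemma ofReal_one_add_sq_rpow_add (x s t : ℝ) :
    ENNReal.ofReal ((1 + x ^ 2) ^ (s + t))
      = ENNReal.ofReal ((1 + x ^ 2) ^ s) * ENNReal.ofReal ((1 + x ^ 2) ^ t) := by
  rw [← ENNReal.ofReal_mul (by positivity), Real.rpow_add (by positivity)]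

lemma ofReal_one_add_sq_rpow_half_sq (x s : ℝ) :
    ENNReal.ofReal ((1 + x ^ 2) ^ (s / 2)) ^ 2 = ENNReal.ofReal ((1 + x ^ 2) ^ s) := by
  rw [sq, ← ofReal_one_add_sq_rpow_add, add_halves]

lemma lintegral_one_add_sq_rpow_ne_top {s : ℝ} (hs : s < -(1 / 2)) :
    (∫⁻ x : ℝ, ENNReal.ofReal ((1 + x ^ 2) ^ s)) ≠ ∞ := by
  have h := integrable_rpow_neg_one_add_norm_sq (E := ℝ) (μ := volume) (r := -2 * s)
    (by simp; linarith)
  refine ne_of_eq_of_ne ?_ h.lintegral_lt_top.ne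
  refine lintegral_congr fun x => ?_
  rw [Real.norm_eq_abs, sq_abs]
  congr 2
  ring

lemma lintegral_weight_mul_enorm_le {σ θ : ℝ} {f : ℝ → ℂ} (hf : Measurable f) :
    ∫⁻ y : ℝ, ENNReal.ofReal ((1 + y ^ 2) ^ (θ / 2)) * (‖f y‖₊ : ℝ≥0∞)
      ≤ (∫⁻ y : ℝ, ENNReal.ofReal ((1 + y ^ 2) ^ (θ - σ))) ^ (1 / 2 : ℝ)
        * (∫⁻ y : ℝ, ENNReal.ofReal ((1 + y ^ 2) ^ σ) * (‖f y‖₊ : ℝ≥0∞) ^ 2) ^ (1 / 2 : ℝ) := by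
  have h := ENNReal.lintegral_mul_le_Lp_mul_Lq volume Real.HolderConjugate.two_two
    (f := fun y : ℝ => ENNReal.ofReal ((1 + y ^ 2) ^ ((θ - σ) / 2)))
    (g := fun y : ℝ => ENNReal.ofReal ((1 + y ^ 2) ^ (σ / 2)) * (‖f y‖₊ : ℝ≥0∞))
    (by fun_prop) (by fun_prop)
  simp only [Pi.mul_apply, ENNReal.rpow_two, mul_pow, ofReal_one_add_sq_rpow_half_sq,
    ← mul_assoc, ← ofReal_one_add_sq_rpow_add] at h
  convert h using 6
  ring

/-- A difference of integral operators whose kernel is dominated by a product of weights is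
bounded from `L²_σ` to `L²_{-σ}`. -/
lemma weighted_norm_integral_sub_le {σ θ M B : ℝ} (hθ : 0 ≤ θ)
    (hS : (∫⁻ y : ℝ, ENNReal.ofReal ((1 + y ^ 2) ^ (θ - σ))) ≠ ∞)
    {K L : ℝ → ℝ → ℂ} (hKm : ∀ x, Measurable (K x)) (hLm : ∀ x, Measurable (L x))
    (hK : ∀ x y, ‖K x y‖ ≤ B) (hL : ∀ x y, ‖L x y‖ ≤ B) (hM : 0 ≤ M)
    (hKL : ∀ x y, ‖K x y - L x y‖ ≤ M * ((1 + x ^ 2) ^ (θ / 2) * (1 + y ^ 2) ^ (θ / 2)))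
    {f : ℝ → ℂ} (hf : Measurable f)
    (hN : (∫⁻ y : ℝ, ENNReal.ofReal ((1 + y ^ 2) ^ σ) * (‖f y‖₊ : ℝ≥0∞) ^ 2) ≠ ∞) :
    (∫⁻ x : ℝ, ENNReal.ofReal ((1 + x ^ 2) ^ (-σ)) *
        (‖(∫ y : ℝ, K x y * f y) - ∫ y : ℝ, L x y * f y‖₊ : ℝ≥0∞) ^ 2) ^ (1 / 2 : ℝ)
      ≤ ENNReal.ofReal M * (∫⁻ y : ℝ, ENNReal.ofReal ((1 + y ^ 2) ^ (θ - σ))) *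
        (∫⁻ y : ℝ, ENNReal.ofReal ((1 + y ^ 2) ^ σ) * (‖f y‖₊ : ℝ≥0∞) ^ 2) ^ (1 / 2 : ℝ) := by
  have hJ := lintegral_weight_mul_enorm_le (σ := σ) (θ := θ) hf
  set S := ∫⁻ y : ℝ, ENNReal.ofReal ((1 + y ^ 2) ^ (θ - σ))
  set N := ∫⁻ y : ℝ, ENNReal.ofReal ((1 + y ^ 2) ^ σ) * (‖f y‖₊ : ℝ≥0∞) ^ 2
  set J := ∫⁻ y : ℝ, ENNReal.ofReal ((1 + y ^ 2) ^ (θ / 2)) * (‖f y‖₊ : ℝ≥0∞)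
  have hfi : Integrable f := by
    refine ⟨hf.aestronglyMeasurable, ?_⟩
    refine lt_of_le_of_lt (lintegral_mono fun y => ?_) (hJ.trans_lt (ENNReal.mul_lt_top
      (ENNReal.rpow_lt_top_of_nonneg (by norm_num) hS)
      (ENNReal.rpow_lt_top_of_nonneg (by norm_num) hN)))
    refine le_mul_of_one_le_left zero_le ?_
    rw [ENNReal.one_le_ofReal]
    exact Real.one_le_rpow (by nlinarith) (by linarith)
  have hpt (x : ℝ) : (‖(∫ y : ℝ, K x y * f y) - ∫ y : ℝ, L x y * f y‖₊ : ℝ≥0∞)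
      ≤ ENNReal.ofReal M * ENNReal.ofReal ((1 + x ^ 2) ^ (θ / 2)) * J := by
    rw [← integral_sub
      (hfi.bdd_mul (hKm x).aestronglyMeasurable (Filter.Eventually.of_forall (hK x)))
      (hfi.bdd_mul (hLm x).aestronglyMeasurable (Filter.Eventually.of_forall (hL x)))]
    refine (enorm_integral_le_lintegral_enorm _).trans ?_
    rw [← lintegral_const_mul _ (by fun_prop)]
    refine lintegral_mono fun y => ?_
    rw [← sub_mul, enorm_mul, ← mul_assoc]
    refine mul_le_mul_left ?_ _
    rw [← ofReal_norm, mul_assoc, ← ENNReal.ofReal_mul (by positivity), ← ENNReal.ofReal_mul hM]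
    exact ENNReal.ofReal_le_ofReal (hKL x y)
  have hmain : (∫⁻ x : ℝ, ENNReal.ofReal ((1 + x ^ 2) ^ (-σ)) *
        (‖(∫ y : ℝ, K x y * f y) - ∫ y : ℝ, L x y * f y‖₊ : ℝ≥0∞) ^ 2)
      ≤ (ENNReal.ofReal M * J) ^ 2 * S := by
    rw [← lintegral_const_mul _ (by fun_prop)]
    refine lintegral_mono fun x => ?_
    calc _ ≤ ENNReal.ofReal ((1 + x ^ 2) ^ (-σ)) *
          (ENNReal.ofReal M * ENNReal.ofReal ((1 + x ^ 2) ^ (θ / 2)) * J) ^ 2 := by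
          gcongr
          exact hpt x
      _ = _ := by
          rw [sub_eq_add_neg, ofReal_one_add_sq_rpow_add, ← ofReal_one_add_sq_rpow_half_sq x θ]
          ring
  have hhalf (a : ℝ≥0∞) : a ^ (1 / 2 : ℝ) * a ^ (1 / 2 : ℝ) = a := by
    rw [← ENNReal.rpow_add_of_nonneg _ _ (by norm_num) (by norm_num)]
    norm_num
  calc _ ≤ ((ENNReal.ofReal M * J) ^ 2 * S) ^ (1 / 2 : ℝ) := by gcongr
    _ = ENNReal.ofReal M * J * S ^ (1 / 2 : ℝ) := by
        rw [ENNReal.mul_rpow_of_nonneg _ _ (by norm_num), ← ENNReal.rpow_natCast,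
          ← ENNReal.rpow_mul]
        norm_num
    _ ≤ ENNReal.ofReal M * (S ^ (1 / 2 : ℝ) * N ^ (1 / 2 : ℝ)) * S ^ (1 / 2 : ℝ) := by gcongr
    _ = ENNReal.ofReal M * (S ^ (1 / 2 : ℝ) * S ^ (1 / 2 : ℝ)) * N ^ (1 / 2 : ℝ) := by ring
    _ = _ := by rw [hhalf]

lemma re_pos_of_sq_im_pos {k : ℂ} {ζ ε : ℝ} (hε : 0 < ε)
    (hk : k ^ 2 = (ζ : ℂ) + (ε : ℂ) * Complex.I) (him : 0 < k.im) : 0 < k.re := by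
  have h := congrArg Complex.im hk
  simp [sq] at h
  nlinarith

lemma sqrt_le_norm_of_sq_eq {k : ℂ} {ζ ε : ℝ} (hk : k ^ 2 = (ζ : ℂ) + (ε : ℂ) * Complex.I) :
    Real.sqrt ζ ≤ ‖k‖ := by
  refine Real.sqrt_le_left (norm_nonneg _) |>.2 ?_
  rw [← norm_pow, hk]
  simpa using Complex.re_le_norm ((ζ : ℂ) + (ε : ℂ) * Complex.I)

lemma norm_sub_sqrt_le {k : ℂ} {r ζ ε : ℝ} (hr : 0 < r) (hζ : r ≤ ζ) (hε : 0 < ε)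
    (hk : k ^ 2 = (ζ : ℂ) + (ε : ℂ) * Complex.I) (him : 0 < k.im) :
    ‖k - (Real.sqrt ζ : ℂ)‖ ≤ ε / Real.sqrt r := by
  have hre := re_pos_of_sq_im_pos hε hk him
  have hsum : Real.sqrt r ≤ ‖k + (Real.sqrt ζ : ℂ)‖ := by
    refine le_trans ?_ (Complex.re_le_norm _)
    simp only [Complex.add_re, Complex.ofReal_re]
    linarith [Real.sqrt_le_sqrt hζ]
  have hprod : (k - (Real.sqrt ζ : ℂ)) * (k + (Real.sqrt ζ : ℂ)) = ε * Complex.I := by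
    have h : ((Real.sqrt ζ : ℂ)) ^ 2 = ζ := by
      exact_mod_cast Real.sq_sqrt (hr.le.trans hζ)
    linear_combination hk - h
  have hnorm := congrArg norm hprod
  rw [norm_mul, norm_mul, Complex.norm_I, mul_one, Complex.norm_real, Real.norm_eq_abs,
    abs_of_pos hε] at hnorm
  rw [le_div_iff₀ (Real.sqrt_pos.2 hr), ← hnorm]
  gcongr

/-- Limiting absorption principle for the free 1D Schrödinger resolvent, uniformly in
`ζ ≥ r`: for `σ > 1/2` and `r > 0`,
`sup_{ζ ≥ r} ‖R₀(ζ+iε) − R₀(ζ+i0)‖_{L(L²_σ,L²_{−σ})} → 0` as `ε → 0+`, where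
`R₀(ζ+iε)` is the integral operator with kernel `−e^{ik|x−y|}/(2ik)`, `k² = ζ+iε`,
`Im k > 0` for `ε > 0`, and `k = √ζ` for `ε = 0`. -/
theorem limiting_absorption_principle (σ r : ℝ) (hσ : 1 / 2 < σ) (hr : 0 < r) :
    ∀ η : ℝ, 0 < η → ∃ ε₀ : ℝ, 0 < ε₀ ∧ ∀ ε : ℝ, 0 < ε → ε ≤ ε₀ →
      ∀ ζ : ℝ, r ≤ ζ → ∀ kε k0 : ℂ,
        kε ^ 2 = (ζ : ℂ) + (ε : ℂ) * Complex.I → 0 < kε.im →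
        k0 = (Real.sqrt ζ : ℂ) →
        ∀ f : ℝ → ℂ, Measurable f →
          (∫⁻ x : ℝ, ENNReal.ofReal ((1 + x ^ 2) ^ (-σ)) *
              (‖(∫ y : ℝ, (-(Complex.exp (Complex.I * kε * (|x - y| : ℝ)))
                    / (2 * Complex.I * kε)) * f y)
                - ∫ y : ℝ, (-(Complex.exp (Complex.I * k0 * (|x - y| : ℝ)))
                    / (2 * Complex.I * k0)) * f y‖₊ : ℝ≥0∞) ^ 2) ^ (1 / 2 : ℝ)
            ≤ ENNReal.ofReal η *
              (∫⁻ y : ℝ, ENNReal.ofReal ((1 + y ^ 2) ^ σ) * (‖f y‖₊ : ℝ≥0∞) ^ 2) ^ (1 / 2 : ℝ) := by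
  intro η hη
  obtain ⟨θ, hθ, hθ1, hθσ⟩ : ∃ θ : ℝ, 0 < θ ∧ θ ≤ 1 ∧ θ - σ < -(1 / 2) :=
    ⟨min 1 ((σ - 1 / 2) / 2), lt_min one_pos (by linarith), min_le_left _ _, by
      linarith [min_le_right 1 ((σ - 1 / 2) / 2)]⟩
  have hS := lintegral_one_add_sq_rpow_ne_top hθσ
  set S := ∫⁻ y : ℝ, ENNReal.ofReal ((1 + y ^ 2) ^ (θ - σ)) with hSdef
  have hR : 0 < Real.sqrt r := Real.sqrt_pos.2 hr
  set R := Real.sqrt r with hRdef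
  have hlim : Filter.Tendsto
      (fun ε : ℝ => 2 * (1 / R + 1 / (2 * R ^ 2)) * (ε / R) ^ θ * S.toReal)
      (nhds 0) (nhds 0) := by
    have hc : ContinuousAt
        (fun ε : ℝ => 2 * (1 / R + 1 / (2 * R ^ 2)) * (ε / R) ^ θ * S.toReal) 0 :=
      ((continuousAt_id.div_const R).rpow_const (Or.inr hθ.le) |>.const_mul _).mul_const _
    simpa [ContinuousAt, Real.zero_rpow hθ.ne'] using hc
  obtain ⟨ρ, hρ, hball⟩ := Metric.eventually_nhds_iff.1 (hlim.eventually (gt_mem_nhds hη))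
  refine ⟨min (ρ / 2) R, lt_min (by linarith) hR, ?_⟩
  intro ε hε hε₀ ζ hζ kε k0 hk him hk0 f hf
  have hsmall := @hball ε (by
    rw [Real.dist_eq, sub_zero, abs_of_pos hε]
    linarith [hε₀.trans (min_le_left _ _)])
  by_cases hN : (∫⁻ y : ℝ, ENNReal.ofReal ((1 + y ^ 2) ^ σ) * (‖f y‖₊ : ℝ≥0∞) ^ 2) = ∞
  · rw [hN, ENNReal.top_rpow_of_pos (by norm_num),
      ENNReal.mul_top (ENNReal.ofReal_pos.2 hη).ne']
    exact le_top
  have hRζ : R ≤ Real.sqrt ζ := Real.sqrt_le_sqrt hζ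
  have hkR : R ≤ ‖kε‖ := hRζ.trans (sqrt_le_norm_of_sq_eq hk)
  have hk0R : R ≤ ‖k0‖ := by
    rw [hk0, Complex.norm_real, Real.norm_eq_abs]
    exact hRζ.trans (le_abs_self _)
  have hk0im : 0 ≤ k0.im := by simp [hk0]
  have hsub : ‖kε - k0‖ ≤ ε / R := hk0 ▸ norm_sub_sqrt_le hr hζ hε hk him
  have hδ : ε / R ≤ 1 := (div_le_one hR).2 (hε₀.trans (min_le_right _ _))
  have hB {k : ℂ} (h : R ≤ ‖k‖) : 1 / (2 * ‖k‖) ≤ 1 / (2 * R) := by gcongr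
  have hM : 0 ≤ 2 * (1 / R + 1 / (2 * R ^ 2)) * (ε / R) ^ θ := by positivity
  refine (weighted_norm_integral_sub_le hθ.le hS (measurable_freeResolventKernel kε)
    (measurable_freeResolventKernel k0)
    (fun x y => (norm_freeResolventKernel_le him.le x y).trans (hB hkR))
    (fun x y => (norm_freeResolventKernel_le hk0im x y).trans (hB hk0R)) hM
    (norm_freeResolventKernel_sub_le him.le hk0im hR hkR hk0R hsub hδ hθ.le hθ1) hf hN).trans ?_
  gcongr
  rw [← hSdef, ← ENNReal.ofReal_toReal hS, ← ENNReal.ofReal_mul hM]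
  exact ENNReal.ofReal_le_ofReal hsmall.le
end
end

section
/- For every σ > 3/2 there exists a constant C > 0 such that for every ζ ∈ ℂ \ [0,∞) with |ζ| ≥ 1, with k ∈ ℂ the square root of ζ with Im k > 0, the integral operator with kernel e^{ik|x−y|}(−|x−y|/(4k²) − i/(4k³)) (which is the ζ-derivative of the free Schrödinger resolvent kernel −e^{ik|x−y|}/(2ik)) is bounded from L²_σ(ℝ) to L²_{−σ}(ℝ) with operator norm at most C|ζ|^{−1}. -/
noncomputable section

open MeasureTheory
open scoped ENNReal NNReal

/-- The weight `(1 + x²)^s` as an extended nonnegative real. -/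
def japaneseWeight (s x : ℝ) : ℝ≥0∞ := ENNReal.ofReal ((1 + x ^ 2) ^ s)

lemma measurable_japaneseWeight (s : ℝ) : Measurable (japaneseWeight s) := by
  unfold japaneseWeight
  fun_prop

lemma japaneseWeight_mul (s t x : ℝ) :
    japaneseWeight s x * japaneseWeight t x = japaneseWeight (s + t) x := by
  unfold japaneseWeight
  rw [← ENNReal.ofReal_mul (by positivity), ← Real.rpow_add (by positivity)]

lemma japaneseWeight_sq (s x : ℝ) : japaneseWeight s x ^ 2 = japaneseWeight (2 * s) x := by
  rw [sq, japaneseWeight_mul, two_mul]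

lemma lintegral_japaneseWeight_lt_top {s : ℝ} (hs : s < -(1 / 2)) :
    ∫⁻ x, japaneseWeight s x < ∞ := by
  have h := integrable_rpow_neg_one_add_norm_sq (E := ℝ) (μ := volume) (r := -2 * s)
    (by simp only [Module.finrank_self, Nat.cast_one]; linarith)
  have h2 : Integrable (fun x : ℝ => (1 + x ^ 2) ^ s) := by
    convert h using 3 with x
    · simp
    · ring
  exact h2.lintegral_lt_top

lemma enorm_integral_le_of_kernel_bound {σ B x : ℝ} (hB : 0 ≤ B) {K f : ℝ → ℂ}
    (hf : Measurable f)
    (hK : ∀ y, ‖K y‖ ≤ B * ((1 + x ^ 2) ^ (1 / 2 : ℝ) * (1 + y ^ 2) ^ (1 / 2 : ℝ))) :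
    ‖∫ y, K y * f y‖ₑ ≤ ENNReal.ofReal B * japaneseWeight (1 / 2) x *
      ((∫⁻ y, japaneseWeight (1 - σ) y) ^ (1 / 2 : ℝ) *
        (∫⁻ y, japaneseWeight σ y * ‖f y‖ₑ ^ 2) ^ (1 / 2 : ℝ)) := by
  have hKe (y : ℝ) : ‖K y‖ₑ ≤
      ENNReal.ofReal B * japaneseWeight (1 / 2) x * japaneseWeight (1 / 2) y := by
    rw [← ofReal_norm, japaneseWeight, japaneseWeight, mul_assoc,
      ← ENNReal.ofReal_mul (by positivity), ← ENNReal.ofReal_mul hB]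
    exact ENNReal.ofReal_le_ofReal (hK y)
  have hg : Measurable (japaneseWeight ((1 - σ) / 2)) := measurable_japaneseWeight _
  have hh : Measurable fun y => japaneseWeight (σ / 2) y * ‖f y‖ₑ :=
    (measurable_japaneseWeight _).mul hf.enorm
  calc ‖∫ y, K y * f y‖ₑ ≤ ∫⁻ y, ‖K y * f y‖ₑ := enorm_integral_le_lintegral_enorm _
    _ ≤ ∫⁻ y, ENNReal.ofReal B * japaneseWeight (1 / 2) x *
          (japaneseWeight ((1 - σ) / 2) y * (japaneseWeight (σ / 2) y * ‖f y‖ₑ)) := by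
        refine lintegral_mono fun y => ?_
        rw [enorm_mul, ← mul_assoc (japaneseWeight _ y), japaneseWeight_mul, ← mul_assoc,
          show (1 - σ) / 2 + σ / 2 = 1 / 2 by ring]
        gcongr
        exact hKe y
    _ = ENNReal.ofReal B * japaneseWeight (1 / 2) x *
          ∫⁻ y, japaneseWeight ((1 - σ) / 2) y * (japaneseWeight (σ / 2) y * ‖f y‖ₑ) :=
        lintegral_const_mul _ (hg.mul hh)
    _ ≤ _ := by
        gcongr
        have := ENNReal.lintegral_mul_le_Lp_mul_Lq volume Real.HolderConjugate.two_two
          hg.aemeasurable hh.aemeasurable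
        simpa only [Pi.mul_apply, ENNReal.rpow_two, mul_pow, japaneseWeight_sq,
          mul_div_cancel₀ _ (two_ne_zero' ℝ), mul_div_cancel_left₀ _ (two_ne_zero' ℝ)] using this

/-- An integral operator whose kernel is dominated by `B ⟨x⟩⟨y⟩` maps `L²_σ` to `L²_{-σ}` with
norm at most `B ∫ ⟨y⟩^{2 (1 - σ)} dy`. -/
lemma weighted_L2_bound_of_kernel_bound (σ : ℝ) {B : ℝ} (hB : 0 ≤ B) {K : ℝ → ℝ → ℂ}
    {f : ℝ → ℂ} (hf : Measurable f)
    (hK : ∀ x y, ‖K x y‖ ≤ B * ((1 + x ^ 2) ^ (1 / 2 : ℝ) * (1 + y ^ 2) ^ (1 / 2 : ℝ))) :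
    (∫⁻ x, japaneseWeight (-σ) x * ‖∫ y, K x y * f y‖ₑ ^ 2) ^ (1 / 2 : ℝ) ≤
      ENNReal.ofReal B * (∫⁻ y, japaneseWeight (1 - σ) y) *
        (∫⁻ y, japaneseWeight σ y * ‖f y‖ₑ ^ 2) ^ (1 / 2 : ℝ) := by
  set A := ∫⁻ y, japaneseWeight (1 - σ) y with hA
  set N := (∫⁻ y, japaneseWeight σ y * ‖f y‖ₑ ^ 2) ^ (1 / 2 : ℝ) with hN
  have hsqrt (a : ℝ≥0∞) : (a ^ 2) ^ (1 / 2 : ℝ) = a := by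
    rw [← ENNReal.rpow_two, ← ENNReal.rpow_mul]; norm_num
  have hsq (a : ℝ≥0∞) : a ^ (1 / 2 : ℝ) * a ^ (1 / 2 : ℝ) = a := by
    rw [← ENNReal.rpow_add_of_nonneg _ _ (by norm_num) (by norm_num)]; norm_num
  calc (∫⁻ x, japaneseWeight (-σ) x * ‖∫ y, K x y * f y‖ₑ ^ 2) ^ (1 / 2 : ℝ)
      ≤ (∫⁻ x, (ENNReal.ofReal B * (A ^ (1 / 2 : ℝ) * N)) ^ 2 *
          japaneseWeight (1 - σ) x) ^ (1 / 2 : ℝ) := by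
        refine ENNReal.rpow_le_rpow (lintegral_mono fun x => ?_) (by norm_num)
        calc japaneseWeight (-σ) x * ‖∫ y, K x y * f y‖ₑ ^ 2
            ≤ japaneseWeight (-σ) x * (ENNReal.ofReal B * japaneseWeight (1 / 2) x *
                (A ^ (1 / 2 : ℝ) * N)) ^ 2 := by
              gcongr
              exact enorm_integral_le_of_kernel_bound hB hf (hK x)
          _ = (ENNReal.ofReal B * (A ^ (1 / 2 : ℝ) * N)) ^ 2 *
                (japaneseWeight (-σ) x * japaneseWeight (1 / 2) x ^ 2) := by ring
          _ = _ := by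
              rw [japaneseWeight_sq, japaneseWeight_mul]
              congr 2
              ring
    _ = ENNReal.ofReal B * (A ^ (1 / 2 : ℝ) * N) * A ^ (1 / 2 : ℝ) := by
        rw [lintegral_const_mul _ (measurable_japaneseWeight _),
          ENNReal.mul_rpow_of_nonneg _ _ (by norm_num), hsqrt]
    _ = ENNReal.ofReal B * (A ^ (1 / 2 : ℝ) * A ^ (1 / 2 : ℝ)) * N := by ring
    _ = _ := by rw [hsq]

lemma one_add_abs_sub_le (x y : ℝ) :
    1 + |x - y| ≤ 2 * ((1 + x ^ 2) ^ (1 / 2 : ℝ) * (1 + y ^ 2) ^ (1 / 2 : ℝ)) := by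
  have h (t : ℝ) : 1 + |t| ≤ √2 * √(1 + t ^ 2) := by
    rw [← Real.sqrt_mul (by norm_num)]
    refine Real.le_sqrt_of_sq_le ?_
    nlinarith [sq_abs t, sq_nonneg (1 - |t|)]
  rw [← Real.sqrt_eq_rpow, ← Real.sqrt_eq_rpow]
  calc 1 + |x - y| ≤ (1 + |x|) * (1 + |y|) := by
        nlinarith [abs_sub x y, abs_nonneg x, abs_nonneg y, mul_nonneg (abs_nonneg x) (abs_nonneg y)]
    _ ≤ (√2 * √(1 + x ^ 2)) * (√2 * √(1 + y ^ 2)) := by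
        gcongr
        exacts [h x, h y]
    _ = (√2 * √2) * (√(1 + x ^ 2) * √(1 + y ^ 2)) := by ring
    _ = _ := by rw [Real.mul_self_sqrt (by norm_num)]

lemma norm_free_resolvent_derivative_kernel_le {k : ℂ} (hk : 1 ≤ ‖k‖) (him : 0 ≤ k.im)
    {r : ℝ} (hr : 0 ≤ r) :
    ‖Complex.exp (Complex.I * k * r) *
      (-(r : ℂ) / (4 * k ^ 2) - Complex.I / (4 * k ^ 3))‖ ≤ (1 + r) / (4 * ‖k‖ ^ 2) := by
  have hexp : ‖Complex.exp (Complex.I * k * r)‖ ≤ 1 := by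
    rw [Complex.norm_exp, Real.exp_le_one_iff]
    simpa using mul_nonneg him hr
  have hk0 : 0 < ‖k‖ := by linarith
  rw [norm_mul]
  calc _ ≤ 1 * ‖-(r : ℂ) / (4 * k ^ 2) - Complex.I / (4 * k ^ 3)‖ := by gcongr
    _ ≤ ‖-(r : ℂ) / (4 * k ^ 2)‖ + ‖Complex.I / (4 * k ^ 3)‖ := by
        rw [one_mul]; exact norm_sub_le _ _
    _ = r / (4 * ‖k‖ ^ 2) + 1 / (4 * ‖k‖ ^ 3) := by
        simp [abs_of_nonneg hr]
    _ ≤ r / (4 * ‖k‖ ^ 2) + 1 / (4 * ‖k‖ ^ 2) := by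
        have : ‖k‖ ^ 2 ≤ ‖k‖ ^ 3 := pow_le_pow_right₀ hk (by norm_num)
        gcongr
    _ = _ := by ring

/-- High-energy bound for the derivative of the free 1D Schrödinger resolvent: for
`σ > 3/2`, the integral operator with kernel `e^{ik|x−y|}(−|x−y|/(4k²) − i/(4k³))`
(where `k² = ζ`, `Im k > 0`, `ζ ∉ [0,∞)`, `|ζ| ≥ 1`) is bounded from `L²_σ` to
`L²_{−σ}` with operator norm at most `C|ζ|^{−1}`. -/
theorem free_resolvent_derivative_high_energy_bound (σ : ℝ) (hσ : 3 / 2 < σ) :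
    ∃ C : ℝ, 0 < C ∧ ∀ ζ k : ℂ,
      (∀ r : ℝ, 0 ≤ r → ζ ≠ (r : ℂ)) → 1 ≤ ‖ζ‖ → k ^ 2 = ζ → 0 < k.im →
      ∀ f : ℝ → ℂ, Measurable f →
        (∫⁻ x : ℝ, ENNReal.ofReal ((1 + x ^ 2) ^ (-σ)) *
            (‖∫ y : ℝ, (Complex.exp (Complex.I * k * (|x - y| : ℝ)) *
                (-(|x - y| : ℝ) / (4 * k ^ 2) - Complex.I / (4 * k ^ 3))) * f y‖₊ : ℝ≥0∞)
              ^ 2) ^ (1 / 2 : ℝ)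
          ≤ ENNReal.ofReal (C * ‖ζ‖ ^ (-1 : ℝ)) *
            (∫⁻ y : ℝ, ENNReal.ofReal ((1 + y ^ 2) ^ σ) * (‖f y‖₊ : ℝ≥0∞) ^ 2) ^ (1 / 2 : ℝ) := by
  set A := ∫⁻ y, japaneseWeight (1 - σ) y with hA
  have hAtop : A ≠ ∞ := (lintegral_japaneseWeight_lt_top (by linarith)).ne
  refine ⟨A.toReal + 1, by positivity, fun ζ k _ hζ hkζ him f hf => ?_⟩
  have hnorm : ‖ζ‖ = ‖k‖ ^ 2 := by rw [← hkζ, norm_pow]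
  have hk : 1 ≤ ‖k‖ := by
    rw [hnorm] at hζ
    exact (one_le_sq_iff₀ (norm_nonneg k)).1 hζ
  have hζ0 : 0 < ‖ζ‖ := by linarith
  refine (weighted_L2_bound_of_kernel_bound σ (B := ‖ζ‖ ^ (-1 : ℝ)) (by positivity) hf
    fun x y => ?_).trans ?_
  · refine (norm_free_resolvent_derivative_kernel_le hk him.le (abs_nonneg (x - y))).trans ?_
    rw [← hnorm, Real.rpow_neg_one, div_le_iff₀ (by positivity)]
    have h := one_add_abs_sub_le x y
    have h1 : 0 ≤ |x - y| := abs_nonneg _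
    calc 1 + |x - y| ≤ 4 * ((1 + x ^ 2) ^ (1 / 2 : ℝ) * (1 + y ^ 2) ^ (1 / 2 : ℝ)) := by linarith
      _ = _ := by field_simp
  · refine mul_le_mul_left ?_ _
    rw [mul_comm (A.toReal + 1), ENNReal.ofReal_mul (by positivity)]
    gcongr
    rw [← hA, ← ENNReal.ofReal_toReal hAtop]
    exact ENNReal.ofReal_le_ofReal (by simp)
end
end

section
/- Let B be a complex Banach space, let m < a be real numbers, and let F : [m,a] → B be continuous on [m,a], twice continuously differentiable on the open interval (m,a), and satisfy F(m) = F(a) = 0 together with the bound ‖F''(ω)‖ ≤ C₀(ω−m)^{−3/2} for all ω ∈ (m,a) and some constant C₀. Then there exists a constant C such that ‖∫_m^a e^{−itω} F(ω) dω‖ ≤ C t^{−3/2} for all t ≥ 1 (the integral being a B-valued Bochner integral). -/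
noncomputable section

open MeasureTheory

/-- A mean value inequality with dominating function `b`, differentiable only in the interior. -/
theorem norm_sub_le_sub_of_norm_hasDerivAt_le {E : Type*} [NormedAddCommGroup E]
    [NormedSpace ℝ E] {g g' : ℝ → E} {b b' : ℝ → ℝ} {x y : ℝ} (hxy : x ≤ y)
    (hg : ContinuousOn g (Set.Icc x y)) (hb : ContinuousOn b (Set.Icc x y))
    (hg' : ∀ z ∈ Set.Ioo x y, HasDerivAt g (g' z) z)
    (hb' : ∀ z ∈ Set.Ioo x y, HasDerivAt b (b' z) z)
    (hle : ∀ z ∈ Set.Ioo x y, ‖g' z‖ ≤ b' z) : ‖g y - g x‖ ≤ b y - b x := by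
  rcases hxy.eq_or_lt with rfl | hlt
  · simp
  have key : ∀ z ∈ Set.Ioo x y, ‖g y - g z‖ ≤ b y - b z := by
    intro z hz
    have hsub : Set.Icc z y ⊆ Set.Icc x y := Set.Icc_subset_Icc_left hz.1.le
    have hmem : ∀ w ∈ Set.Ico z y, w ∈ Set.Ioo x y := fun w hw => ⟨hz.1.trans_le hw.1, hw.2⟩
    refine image_norm_le_of_norm_deriv_right_le_deriv_boundary' (a := z) (b := y)
      (f := fun w => g w - g z) (f' := g') (B := fun w => b w - b z) (B' := b')
      ((hg.mono hsub).sub continuousOn_const)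
      (fun w hw => ((hg' w (hmem w hw)).sub_const _).hasDerivWithinAt) (by simp)
      ((hb.mono hsub).sub continuousOn_const)
      (fun w hw => ((hb' w (hmem w hw)).sub_const _).hasDerivWithinAt)
      (fun w hw => hle w (hmem w hw)) ⟨hz.2.le, le_rfl⟩
  have hgx := (hg x (Set.left_mem_Icc.2 hxy)).mono Set.Ioo_subset_Icc_self
  have hbx := (hb x (Set.left_mem_Icc.2 hxy)).mono Set.Ioo_subset_Icc_self
  have : (nhdsWithin x (Set.Ioo x y)).NeBot := left_nhdsWithin_Ioo_neBot hlt
  exact le_of_tendsto_of_tendsto (tendsto_const_nhds.sub hgx).norm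
    (tendsto_const_nhds.sub hbx) (eventually_mem_nhdsWithin.mono key)

theorem hasDerivAt_const_mul_sub_rpow (c m p : ℝ) {z : ℝ} (hz : m < z) :
    HasDerivAt (fun w => c * (w - m) ^ p) (c * (p * (z - m) ^ (p - 1))) z := by
  have h := ((hasDerivAt_id z).sub_const m).rpow_const (p := p) (Or.inl (sub_pos.2 hz).ne')
  simpa using h.const_mul c

/-- Integrating a bound of order `(ω - m)^(-3/2)` on the derivative. -/
theorem norm_sub_le_of_norm_hasDerivAt_le_rpow {E : Type*} [NormedAddCommGroup E]
    [NormedSpace ℝ E] {g g' : ℝ → E} {m x y c : ℝ} (hc : 0 ≤ c) (hmx : m < x) (hxy : x ≤ y)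
    (hgc : ContinuousOn g (Set.Icc x y)) (hg : ∀ z ∈ Set.Ioo x y, HasDerivAt g (g' z) z)
    (hle : ∀ z ∈ Set.Ioo x y, ‖g' z‖ ≤ c * (z - m) ^ (-(3 : ℝ) / 2)) :
    ‖g y - g x‖ ≤ 2 * c * (x - m) ^ (-(1 : ℝ) / 2) := by
  have hb : ∀ z ∈ Set.Icc x y, HasDerivAt (fun w => -2 * c * (w - m) ^ (-(1 : ℝ) / 2))
      (c * (z - m) ^ (-(3 : ℝ) / 2)) z := by
    intro z hz
    convert hasDerivAt_const_mul_sub_rpow (-2 * c) m (-(1 : ℝ) / 2) (hmx.trans_le hz.1) using 1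
    rw [show -(1 : ℝ) / 2 - 1 = -3 / 2 by norm_num]
    ring
  have h := norm_sub_le_sub_of_norm_hasDerivAt_le hxy hgc
    (fun z hz => (hb z hz).continuousAt.continuousWithinAt) hg
    (fun z hz => hb z (Set.Ioo_subset_Icc_self hz)) hle
  have hy : 0 ≤ c * (y - m) ^ (-(1 : ℝ) / 2) :=
    mul_nonneg hc (Real.rpow_nonneg (by linarith) _)
  linarith

theorem exists_norm_le_rpow_of_norm_hasDerivAt_le_rpow {E : Type*} [NormedAddCommGroup E]
    [NormedSpace ℝ E] {g g' : ℝ → E} {m a c : ℝ} (hc : 0 ≤ c) (hma : m < a)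
    (hg : ∀ z ∈ Set.Ioo m a, HasDerivAt g (g' z) z)
    (hle : ∀ z ∈ Set.Ioo m a, ‖g' z‖ ≤ c * (z - m) ^ (-(3 : ℝ) / 2)) :
    ∃ K : ℝ, 0 ≤ K ∧ ∀ z ∈ Set.Ioo m a, ‖g z‖ ≤ K * (z - m) ^ (-(1 : ℝ) / 2) := by
  obtain ⟨d, hd⟩ := exists_between hma
  set A := ‖g d‖ + 2 * c * (d - m) ^ (-(1 : ℝ) / 2) with hA
  have hdm : 0 < d - m := sub_pos.2 hd.1
  have ham : 0 < a - m := sub_pos.2 hma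
  have hA0 : 0 ≤ A := by positivity
  refine ⟨A * (a - m) ^ ((1 : ℝ) / 2) + 2 * c, by positivity, fun z hz => ?_⟩
  have hzm : 0 < z - m := sub_pos.2 hz.1
  have hone : 1 ≤ (a - m) ^ ((1 : ℝ) / 2) * (z - m) ^ (-(1 : ℝ) / 2) := by
    rw [neg_div, Real.rpow_neg hzm.le, ← div_eq_mul_inv, one_le_div (by positivity)]
    exact Real.rpow_le_rpow hzm.le (by linarith [hz.2]) (by norm_num)
  have hAz : A ≤ A * ((a - m) ^ ((1 : ℝ) / 2) * (z - m) ^ (-(1 : ℝ) / 2)) :=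
    le_mul_of_one_le_right hA0 hone
  have hsplit : ‖g z‖ ≤ A + 2 * c * (z - m) ^ (-(1 : ℝ) / 2) := by
    have hpos : 0 ≤ 2 * c * (z - m) ^ (-(1 : ℝ) / 2) := by positivity
    have hpos' : 0 ≤ 2 * c * (d - m) ^ (-(1 : ℝ) / 2) := by positivity
    rcases le_total z d with hzd | hdz
    · have hsub : ∀ w ∈ Set.Icc z d, w ∈ Set.Ioo m a :=
        fun w hw => ⟨hz.1.trans_le hw.1, hw.2.trans_lt hd.2⟩
      have h := norm_sub_le_of_norm_hasDerivAt_le_rpow hc hz.1 hzd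
        (fun w hw => (hg w (hsub w hw)).continuousAt.continuousWithinAt)
        (fun w hw => hg w (hsub w (Set.Ioo_subset_Icc_self hw)))
        (fun w hw => hle w (hsub w (Set.Ioo_subset_Icc_self hw)))
      have := norm_sub_norm_le (g z) (g d)
      rw [norm_sub_rev] at this
      linarith
    · have hsub : ∀ w ∈ Set.Icc d z, w ∈ Set.Ioo m a :=
        fun w hw => ⟨hd.1.trans_le hw.1, hw.2.trans_lt hz.2⟩
      have h := norm_sub_le_of_norm_hasDerivAt_le_rpow hc hd.1 hdz
        (fun w hw => (hg w (hsub w hw)).continuousAt.continuousWithinAt)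
        (fun w hw => hg w (hsub w (Set.Ioo_subset_Icc_self hw)))
        (fun w hw => hle w (hsub w (Set.Ioo_subset_Icc_self hw)))
      have := norm_sub_norm_le (g z) (g d)
      linarith
  linarith

theorem norm_le_rpow_of_norm_hasDerivAt_le_rpow {E : Type*} [NormedAddCommGroup E]
    [NormedSpace ℝ E] {g g' : ℝ → E} {m a K : ℝ} (hgc : ContinuousOn g (Set.Icc m a))
    (hg : ∀ z ∈ Set.Ioo m a, HasDerivAt g (g' z) z)
    (hle : ∀ z ∈ Set.Ioo m a, ‖g' z‖ ≤ K * (z - m) ^ (-(1 : ℝ) / 2)) (hgm : g m = 0)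
    {y : ℝ} (hy : y ∈ Set.Icc m a) : ‖g y‖ ≤ 2 * K * (y - m) ^ ((1 : ℝ) / 2) := by
  have hsub : ∀ w ∈ Set.Ioo m y, w ∈ Set.Ioo m a := fun w hw => ⟨hw.1, hw.2.trans_le hy.2⟩
  have h := norm_sub_le_sub_of_norm_hasDerivAt_le (b := fun w => 2 * K * (w - m) ^ ((1 : ℝ) / 2))
    (b' := fun w => K * (w - m) ^ (-(1 : ℝ) / 2)) hy.1
    (hgc.mono (Set.Icc_subset_Icc_right hy.2))
    (continuousOn_const.mul ((continuousOn_id.sub continuousOn_const).rpow_const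
      fun _ _ => Or.inr (by norm_num)))
    (fun w hw => hg w (hsub w hw))
    (fun w hw => by
      convert hasDerivAt_const_mul_sub_rpow (2 * K) m ((1 : ℝ) / 2) hw.1 using 1
      rw [show (1 : ℝ) / 2 - 1 = -1 / 2 by norm_num]
      ring)
    (fun w hw => hle w (hsub w hw))
  simpa [hgm] using h

theorem norm_exp_neg_I_mul_mul (t ω : ℝ) : ‖Complex.exp (-Complex.I * t * ω)‖ = 1 := by
  rw [show -Complex.I * t * ω = ((-(t * ω) : ℝ) : ℂ) * Complex.I by push_cast; ring]
  exact Complex.norm_exp_ofReal_mul_I _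

theorem hasDerivAt_exp_neg_I_mul_mul (t ω : ℝ) :
    HasDerivAt (fun w : ℝ => Complex.exp (-Complex.I * t * w))
      (-Complex.I * t * Complex.exp (-Complex.I * t * ω)) ω := by
  have h := ((hasDerivAt_id (ω : ℂ)).const_mul (-Complex.I * t)).cexp.comp_ofReal
  simpa [mul_comm] using h

section

variable {B : Type*} [NormedAddCommGroup B] [NormedSpace ℂ B]

theorem hasDerivAt_exp_smul_antiderivative {F F' F'' : ℝ → B} {t ω : ℝ} (ht : t ≠ 0)
    (hF : HasDerivAt F (F' ω) ω) (hF' : HasDerivAt F' (F'' ω) ω) :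
    HasDerivAt (fun w : ℝ => Complex.exp (-Complex.I * t * w) •
        ((-Complex.I * t)⁻¹ • F w - ((-Complex.I * t) ^ 2)⁻¹ • F' w))
      (Complex.exp (-Complex.I * t * ω) • F ω -
        (((-Complex.I * t) ^ 2)⁻¹ * Complex.exp (-Complex.I * t * ω)) • F'' ω) ω := by
  have hc : -Complex.I * (t : ℂ) ≠ 0 := by simp [ht]
  have h := (hasDerivAt_exp_neg_I_mul_mul t ω).fun_smul
    ((hF.fun_const_smul (-Complex.I * (t : ℂ))⁻¹).fun_sub
      (hF'.fun_const_smul ((-Complex.I * (t : ℂ)) ^ 2)⁻¹))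
  convert h using 1
  generalize -Complex.I * (t : ℂ) = c at hc ⊢
  match_scalars <;> field_simp
  ring

theorem norm_integral_exp_smul_le_left {F : ℝ → B} {m x t K : ℝ} (hmx : m ≤ x) (hK : 0 ≤ K)
    (hF : ∀ z ∈ Set.Icc m x, ‖F z‖ ≤ 2 * K * (z - m) ^ ((1 : ℝ) / 2)) :
    ‖∫ ω in m..x, Complex.exp (-Complex.I * t * ω) • F ω‖ ≤
      2 * K * (x - m) ^ ((3 : ℝ) / 2) := by
  have h := intervalIntegral.norm_integral_le_of_norm_le_const (a := m) (b := x)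
    (f := fun ω : ℝ => Complex.exp (-Complex.I * t * ω) • F ω)
    (C := 2 * K * (x - m) ^ ((1 : ℝ) / 2)) fun z hz => by
      rw [Set.uIoc_of_le hmx] at hz
      rw [norm_smul, norm_exp_neg_I_mul_mul, one_mul]
      refine (hF z ⟨hz.1.le, hz.2⟩).trans ?_
      have := hz.1
      gcongr
      exact hz.2
  refine h.trans_eq ?_
  rw [abs_of_nonneg (sub_nonneg.2 hmx), mul_assoc,
    show (3 : ℝ) / 2 = 1 / 2 + 1 by norm_num,
    Real.rpow_add_one' (sub_nonneg.2 hmx) (by norm_num)]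

variable [CompleteSpace B]

/-- Two integrations by parts on `[x, y]`, the remainder being absorbed into the boundary term. -/
theorem norm_integral_exp_smul_le {F F' F'' : ℝ → B} {m x y t c : ℝ} (hc : 0 ≤ c) (ht : 0 < t)
    (hmx : m < x) (hxy : x ≤ y)
    (hF : ∀ z ∈ Set.Icc x y, HasDerivAt F (F' z) z)
    (hF' : ∀ z ∈ Set.Icc x y, HasDerivAt F' (F'' z) z)
    (hle : ∀ z ∈ Set.Icc x y, ‖F'' z‖ ≤ c * (z - m) ^ (-(3 : ℝ) / 2)) :
    ‖∫ ω in x..y, Complex.exp (-Complex.I * t * ω) • F ω‖ ≤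
      (‖F x‖ + ‖F y‖) / t +
        (‖F' x‖ + ‖F' y‖ + 2 * c * (x - m) ^ (-(1 : ℝ) / 2)) / t ^ 2 := by
  have hexp : Continuous fun ω : ℝ => Complex.exp (-Complex.I * t * ω) := by fun_prop
  have hcont : ContinuousOn (fun ω : ℝ => Complex.exp (-Complex.I * t * ω) • F ω)
      (Set.Icc x y) :=
    hexp.continuousOn.smul fun z hz => (hF z hz).continuousAt.continuousWithinAt
  set P : ℝ → B := fun z => ∫ ω in x..z, Complex.exp (-Complex.I * t * ω) • F ω
  set G : ℝ → B := fun w => Complex.exp (-Complex.I * t * w) •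
    ((-Complex.I * t)⁻¹ • F w - ((-Complex.I * t) ^ 2)⁻¹ • F' w) with hG
  have hnorm : ‖-Complex.I * (t : ℂ)‖ = t := by simp [abs_of_pos ht]
  have hGle : ∀ w, ‖G w‖ ≤ ‖F w‖ / t + ‖F' w‖ / t ^ 2 := fun w => by
    rw [hG, norm_smul, norm_exp_neg_I_mul_mul, one_mul]
    refine (norm_sub_le _ _).trans_eq ?_
    rw [norm_smul, norm_smul, norm_inv, norm_inv, norm_pow, hnorm]
    ring
  have hGderiv := fun z hz => hasDerivAt_exp_smul_antiderivative ht.ne' (hF z hz) (hF' z hz)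
  have hPcont : ContinuousOn P (Set.Icc x y) := by
    have h := intervalIntegral.continuousOn_primitive_interval (μ := volume)
      (f := fun ω : ℝ => Complex.exp (-Complex.I * t * ω) • F ω) (a := x) (b := y)
      (by rw [Set.uIcc_of_le hxy]; exact hcont.integrableOn_Icc)
    rwa [Set.uIcc_of_le hxy] at h
  have hPderiv : ∀ z ∈ Set.Ioo x y,
      HasDerivAt P (Complex.exp (-Complex.I * t * z) • F z) z := fun z hz =>
    intervalIntegral.integral_hasDerivAt_right
      ((hcont.mono (Set.Icc_subset_Icc_right hz.2.le)).intervalIntegrable_of_Icc hz.1.le)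
      ((hcont.mono Set.Ioo_subset_Icc_self).stronglyMeasurableAtFilter isOpen_Ioo z hz)
      (hcont.continuousAt (Icc_mem_nhds hz.1 hz.2))
  have h := norm_sub_le_of_norm_hasDerivAt_le_rpow (g := fun z => P z - G z)
    (c := c / t ^ 2) (by positivity) hmx hxy
    (hPcont.sub fun z hz => (hGderiv z hz).continuousAt.continuousWithinAt)
    (fun z hz => (hPderiv z hz).sub (hGderiv z (Set.Ioo_subset_Icc_self hz)))
    (fun z hz => by
      rw [sub_sub_cancel, norm_smul, norm_mul, norm_exp_neg_I_mul_mul, norm_inv, norm_pow, hnorm,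
        mul_one, inv_mul_eq_div, div_mul_eq_mul_div]
      exact div_le_div_of_nonneg_right (hle z (Set.Ioo_subset_Icc_self hz)) (by positivity))
  have hPx : P x = 0 := intervalIntegral.integral_same
  have hsum : P y = (P y - G y - (P x - G x)) + (G y - G x) := by rw [hPx]; abel
  change ‖P y‖ ≤ _
  rw [hsum]
  calc _ ≤ _ := norm_add_le_of_le h ((norm_sub_le _ _).trans (add_le_add (hGle y) (hGle x)))
    _ = _ := by ring

theorem norm_integral_exp_smul_le_right {F F' F'' : ℝ → B} {m a x t c K : ℝ} (hc : 0 ≤ c)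
    (hK : 0 ≤ K) (ht : 0 < t) (hmx : m < x) (hxa : x < a)
    (hFc : ContinuousOn F (Set.Icc m a)) (hFa : F a = 0)
    (hF : ∀ z ∈ Set.Ioo m a, HasDerivAt F (F' z) z)
    (hF' : ∀ z ∈ Set.Ioo m a, HasDerivAt F' (F'' z) z)
    (hle : ∀ z ∈ Set.Ioo m a, ‖F'' z‖ ≤ c * (z - m) ^ (-(3 : ℝ) / 2))
    (hle' : ∀ z ∈ Set.Ioo m a, ‖F' z‖ ≤ K * (z - m) ^ (-(1 : ℝ) / 2)) :
    ‖∫ ω in x..a, Complex.exp (-Complex.I * t * ω) • F ω‖ ≤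
      ‖F x‖ / t + (2 * K + 2 * c) * (x - m) ^ (-(1 : ℝ) / 2) / t ^ 2 := by
  have hsub : Set.Icc x a ⊆ Set.Icc m a := Set.Icc_subset_Icc_left hmx.le
  have hint : IntegrableOn (fun ω : ℝ => Complex.exp (-Complex.I * t * ω) • F ω)
      (Set.Icc x a) := by
    refine ContinuousOn.integrableOn_Icc (ContinuousOn.smul ?_ (hFc.mono hsub))
    fun_prop
  have hne : (nhdsWithin a (Set.Ioo x a)).NeBot := right_nhdsWithin_Ioo_neBot hxa
  have hprim : ContinuousWithinAt
      (fun y => ∫ ω in x..y, Complex.exp (-Complex.I * t * ω) • F ω) (Set.Ioo x a) a := by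
    have h := intervalIntegral.continuousOn_primitive_interval (μ := volume)
      (f := fun ω : ℝ => Complex.exp (-Complex.I * t * ω) • F ω) (a := x) (b := a)
      (by rwa [Set.uIcc_of_le hxa.le])
    rw [Set.uIcc_of_le hxa.le] at h
    exact (h a (Set.right_mem_Icc.2 hxa.le)).mono Set.Ioo_subset_Icc_self
  have hFlim : ContinuousWithinAt F (Set.Ioo x a) a :=
    (hFc a (Set.right_mem_Icc.2 (hmx.trans hxa).le)).mono
      (Set.Ioo_subset_Icc_self.trans hsub)
  have hlim := (((tendsto_const_nhds (x := ‖F x‖)).add hFlim.norm).div_const t).add_const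
    ((2 * K + 2 * c) * (x - m) ^ (-(1 : ℝ) / 2) / t ^ 2)
  simp only [hFa, norm_zero, add_zero] at hlim
  refine le_of_tendsto_of_tendsto hprim.norm hlim (eventually_mem_nhdsWithin.mono fun y hy => ?_)
  have hmem : ∀ z ∈ Set.Icc x y, z ∈ Set.Ioo m a :=
    fun z hz => ⟨hmx.trans_le hz.1, hz.2.trans_lt hy.2⟩
  refine (norm_integral_exp_smul_le hc ht hmx hy.1.le (fun z hz => hF z (hmem z hz))
    (fun z hz => hF' z (hmem z hz)) (fun z hz => hle z (hmem z hz))).trans ?_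
  have hx := hle' x ⟨hmx, hxa⟩
  have hy' : ‖F' y‖ ≤ K * (x - m) ^ (-(1 : ℝ) / 2) :=
    (hle' y ⟨hmx.trans hy.1, hy.2⟩).trans (mul_le_mul_of_nonneg_left
      (Real.rpow_le_rpow_of_nonpos (sub_pos.2 hmx) (by linarith [hy.1]) (by norm_num)) hK)
  refine add_le_add le_rfl (div_le_div_of_nonneg_right ?_ (by positivity))
  linarith

end

/-- Jensen–Kato-type oscillatory-integral lemma: if `F : [m,a] → B` is continuous on
`[m,a]`, twice continuously differentiable on `(m,a)`, vanishes at both endpoints, and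
`‖F''(ω)‖ ≤ C₀(ω−m)^{−3/2}` on `(m,a)`, then `‖∫_m^a e^{−itω}F(ω)dω‖ ≤ C t^{−3/2}`
for all `t ≥ 1`. -/
theorem oscillatory_integral_decay {B : Type*} [NormedAddCommGroup B]
    [NormedSpace ℂ B] [CompleteSpace B]
    {m a : ℝ} (hma : m < a) (F F' F'' : ℝ → B) (C₀ : ℝ)
    (hFc : ContinuousOn F (Set.Icc m a))
    (hF' : ∀ ω ∈ Set.Ioo m a, HasDerivAt F (F' ω) ω)
    (hF'' : ∀ ω ∈ Set.Ioo m a, HasDerivAt F' (F'' ω) ω)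
    (hF''c : ContinuousOn F'' (Set.Ioo m a))
    (hFm : F m = 0) (hFa : F a = 0)
    (hbound : ∀ ω ∈ Set.Ioo m a, ‖F'' ω‖ ≤ C₀ * (ω - m) ^ (-(3 : ℝ) / 2)) :
    ∃ C : ℝ, ∀ t : ℝ, 1 ≤ t →
      ‖∫ ω in m..a, Complex.exp (-Complex.I * t * ω) • F ω‖
        ≤ C * t ^ (-(3 : ℝ) / 2) := by
  obtain ⟨d, hd⟩ := exists_between hma
  have hC₀ : 0 ≤ C₀ := nonneg_of_mul_nonneg_left ((norm_nonneg _).trans (hbound d hd))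
    (Real.rpow_pos_of_pos (sub_pos.2 hd.1) _)
  obtain ⟨K, hK, hF'le⟩ :=
    exists_norm_le_rpow_of_norm_hasDerivAt_le_rpow hC₀ hma hF'' hbound
  have hFle : ∀ z ∈ Set.Icc m a, ‖F z‖ ≤ 2 * K * (z - m) ^ ((1 : ℝ) / 2) :=
    fun z hz => norm_le_rpow_of_norm_hasDerivAt_le_rpow hFc hF' hF'le hFm hz
  refine ⟨6 * K + 2 * C₀, fun t ht => ?_⟩
  have ht0 : 0 < t := one_pos.trans_le ht
  have hinv : ∀ p : ℝ, (1 / t) ^ p = t ^ (-p) := fun p => by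
    rw [one_div, Real.inv_rpow ht0.le, Real.rpow_neg ht0.le]
  have htp : 0 < t ^ (-(3 : ℝ) / 2) := Real.rpow_pos_of_pos ht0 _
  rcases le_or_gt a (m + 1 / t) with hat | hat
  · refine (norm_integral_exp_smul_le_left hma.le hK hFle).trans ?_
    have h : (a - m) ^ ((3 : ℝ) / 2) ≤ t ^ (-(3 : ℝ) / 2) := by
      rw [neg_div, ← hinv]
      exact Real.rpow_le_rpow (by linarith) (by linarith) (by norm_num)
    exact mul_le_mul (by linarith) h (Real.rpow_nonneg (by linarith) _) (by linarith)
  · have hmx : m < m + 1 / t := by simpa using ht0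
    have hcont : ContinuousOn (fun ω : ℝ => Complex.exp (-Complex.I * t * ω) • F ω)
        (Set.Icc m a) := ContinuousOn.smul (by fun_prop) hFc
    have hi₁ := (hcont.mono (Set.Icc_subset_Icc_right hat.le)).intervalIntegrable_of_Icc
      (μ := volume) hmx.le
    have hi₂ := (hcont.mono (Set.Icc_subset_Icc_left hmx.le)).intervalIntegrable_of_Icc
      (μ := volume) hat.le
    rw [← intervalIntegral.integral_add_adjacent_intervals hi₁ hi₂]
    have h₁ := norm_integral_exp_smul_le_left (t := t) hmx.le hK
      fun z hz => hFle z ⟨hz.1, hz.2.trans hat.le⟩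
    have h₂ := norm_integral_exp_smul_le_right hC₀ hK ht0 hmx hat hFc hFa hF' hF'' hbound hF'le
    have h₃ := div_le_div_of_nonneg_right (hFle _ ⟨hmx.le, hat.le⟩) ht0.le
    rw [add_sub_cancel_left, hinv] at h₁ h₂ h₃
    rw [mul_div_assoc, ← Real.rpow_sub_one ht0.ne'] at h₃
    rw [mul_div_assoc, ← Real.rpow_natCast, ← Real.rpow_sub ht0] at h₂
    norm_num at h₁ h₂ h₃ ⊢
    refine (norm_add_le _ _).trans ?_
    linarith
end
end

section
/- Let V : ℝ → M₂(ℂ) be continuous with V(x) Hermitian for every x and ‖V(x)‖ ≤ C(1+|x|)^{−β} for some β > 1 and C > 0. Let ζ > 0. If u : ℝ → ℂ² is twice continuously differentiable, satisfies −u''(x) + V(x)u(x) = ζ u(x) for all x ∈ ℝ, and is square integrable (∫_ℝ |u(x)|² dx < ∞), then u ≡ 0. That is, the matrix Schrödinger operator −d²/dx² + V on the line has no positive (embedded) eigenvalues. -/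
noncomputable section

open MeasureTheory

open scoped RealInnerProductSpace

section AbstractSchrodinger

variable {H : Type*} [NormedAddCommGroup H] [InnerProductSpace ℝ H]
  {u v W : ℝ → H} {g : ℝ → ℝ} {ζ : ℝ}

/-- The energy of a solution of `u'' = W - ζ u` with `‖W‖ ≤ g ‖u‖` and `g` integrable stays
bounded away from zero to the right of any point where it does not vanish. -/
theorem exists_pos_le_energy (hζ : 0 < ζ)
    (hu : ∀ x, HasDerivAt u (v x) x) (hv : ∀ x, HasDerivAt v (W x - ζ • u x) x)
    (hW : ∀ x, ‖W x‖ ≤ g x * ‖u x‖) (hgc : Continuous g) (hg0 : ∀ x, 0 ≤ g x)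
    (hgi : Integrable g) {x₀ : ℝ} (h0 : u x₀ ≠ 0) :
    ∃ c > 0, ∀ x ≥ x₀, c ≤ ‖v x‖ ^ 2 + ζ * ‖u x‖ ^ 2 := by
  set κ : ℝ := 1 + 1 / ζ with hκ
  have hκ0 : 0 < κ := by positivity
  set E : ℝ → ℝ := fun x => ‖v x‖ ^ 2 + ζ * ‖u x‖ ^ 2 with hE
  set Φ : ℝ → ℝ := fun x => ∫ t in x₀..x, g t with hΦ
  have hE' : ∀ x, HasDerivAt E (2 * ⟪v x, W x⟫) x := by
    intro x
    refine ((hv x).norm_sq.add ((hu x).norm_sq.const_mul ζ)).congr_deriv ?_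
    rw [inner_sub_right, inner_smul_right, real_inner_comm (u x) (v x)]
    ring
  have hΦ' : ∀ x, HasDerivAt Φ (g x) x := fun x =>
    intervalIntegral.integral_hasDerivAt_right (hgc.intervalIntegrable _ _)
      (hgc.stronglyMeasurableAtFilter _ _) hgc.continuousAt
  have hE_lower : ∀ x, -(κ * g x * E x) ≤ 2 * ⟪v x, W x⟫ := by
    intro x
    have h1 : |⟪v x, W x⟫| ≤ ‖v x‖ * (g x * ‖u x‖) :=
      (abs_real_inner_le_norm _ _).trans (by gcongr; exact hW x)
    have h2 : ‖u x‖ ^ 2 + ‖v x‖ ^ 2 ≤ κ * E x := by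
      have : κ * E x = ‖u x‖ ^ 2 + ‖v x‖ ^ 2 + (ζ * ‖u x‖ ^ 2 + ‖v x‖ ^ 2 / ζ) := by
        simp only [hκ, hE]; field_simp; ring
      rw [this]
      exact le_add_of_nonneg_right (by positivity)
    have h3 : g x * (2 * ‖v x‖ * ‖u x‖) ≤ g x * (κ * E x) :=
      mul_le_mul_of_nonneg_left (by nlinarith [sq_nonneg (‖u x‖ - ‖v x‖)]) (hg0 x)
    nlinarith [neg_abs_le ⟪v x, W x⟫]
  have hmono : Monotone fun x => E x * Real.exp (κ * Φ x) := by
    have hd : ∀ x, HasDerivAt (fun x => E x * Real.exp (κ * Φ x))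
        (2 * ⟪v x, W x⟫ * Real.exp (κ * Φ x) + E x * (Real.exp (κ * Φ x) * (κ * g x))) x :=
      fun x => (hE' x).mul ((hΦ' x).const_mul κ).exp
    refine monotone_of_hasDerivAt_nonneg hd fun x => ?_
    have := mul_nonneg (by linarith [hE_lower x] : 0 ≤ 2 * ⟪v x, W x⟫ + κ * g x * E x)
      (Real.exp_pos (κ * Φ x)).le
    simp only [Pi.zero_apply]
    linarith
  have hE0 : 0 < E x₀ := by
    have := norm_pos_iff.2 h0
    positivity
  refine ⟨E x₀ * Real.exp (-(κ * ∫ t, g t)), by positivity, fun x hx => ?_⟩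
  have h1 : E x₀ ≤ E x * Real.exp (κ * Φ x) := by simpa [hΦ] using hmono hx
  have h2 : Φ x ≤ ∫ t, g t := by
    simp only [hΦ]
    rw [intervalIntegral.integral_of_le hx]
    exact setIntegral_le_integral hgi (ae_of_all _ hg0)
  have hEx : 0 ≤ E x := by positivity
  calc E x₀ * Real.exp (-(κ * ∫ t, g t))
      ≤ E x * Real.exp (κ * ∫ t, g t) * Real.exp (-(κ * ∫ t, g t)) := by
        gcongr
        exact h1.trans (by gcongr)
    _ = E x := by rw [mul_assoc, ← Real.exp_add]; simp

/-- A function dominating a nonconstant affine function with positive slope near `+∞` is not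
integrable. -/
theorem not_integrable_of_affine_le {N : ℝ → ℝ} {a b x₁ : ℝ} (ha : 0 < a)
    (h : ∀ x ≥ x₁, a * x + b ≤ N x) : ¬ Integrable N := by
  intro hN
  set x₂ : ℝ := max x₁ ((1 - b) / a)
  have h1 : ∀ x ∈ Set.Ioi x₂, 1 ≤ N x := by
    intro x hx
    have hx1 : x₁ ≤ x := (le_max_left _ _).trans (le_of_lt hx)
    have hx2 : (1 - b) / a ≤ x := (le_max_right _ _).trans (le_of_lt hx)
    rw [div_le_iff₀ ha] at hx2
    linarith [h x hx1]
  have h2 : IntegrableOn (fun _ : ℝ => (1 : ℝ)) (Set.Ioi x₂) := by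
    refine Integrable.mono' hN.integrableOn aestronglyMeasurable_const ?_
    filter_upwards [ae_restrict_mem measurableSet_Ioi] with x hx
    simpa using h1 x hx
  simp [integrableOn_const_iff] at h2

/-- Square-integrable solutions of `u'' = W - ζ u`, `ζ > 0`, vanish when `‖W‖ ≤ g ‖u‖` with `g`
bounded and integrable. -/
theorem eq_zero_of_integrable_norm_sq {B : ℝ} (hζ : 0 < ζ)
    (hu : ∀ x, HasDerivAt u (v x) x) (hv : ∀ x, HasDerivAt v (W x - ζ • u x) x)
    (hW : ∀ x, ‖W x‖ ≤ g x * ‖u x‖) (hgc : Continuous g) (hg0 : ∀ x, 0 ≤ g x)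
    (hgi : Integrable g) (hgB : ∀ x, g x ≤ B) (hint : Integrable fun x => ‖u x‖ ^ 2) (x₀ : ℝ) :
    u x₀ = 0 := by
  by_contra h0
  obtain ⟨c, hc, hcE⟩ := exists_pos_le_energy hζ hu hv hW hgc hg0 hgi h0
  set K : ℝ := 2 * ζ + B with hK
  have hK0 : 0 ≤ K := by linarith [hg0 0, hgB 0]
  have huc : Continuous fun x => ‖u x‖ ^ 2 :=
    (continuous_iff_continuousAt.2 fun x => (hu x).continuousAt).norm.pow 2
  set M : ℝ → ℝ := fun x => ∫ t in x₀..x, ‖u t‖ ^ 2 with hM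
  have hM' : ∀ x, HasDerivAt M (‖u x‖ ^ 2) x := fun x =>
    intervalIntegral.integral_hasDerivAt_right (huc.intervalIntegrable _ _)
      (huc.stronglyMeasurableAtFilter _ _) huc.continuousAt
  set F : ℝ → ℝ := fun x => ⟪u x, v x⟫ with hF
  have hF' : ∀ x, HasDerivAt F (⟪u x, W x - ζ • u x⟫ + ⟪v x, v x⟫) x := fun x =>
    (hu x).inner ℝ (hv x)
  have hF_lower : ∀ x ≥ x₀, c - K * ‖u x‖ ^ 2 ≤ ⟪u x, W x - ζ • u x⟫ + ⟪v x, v x⟫ := by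
    intro x hx
    rw [inner_sub_right, inner_smul_right, real_inner_self_eq_norm_sq, real_inner_self_eq_norm_sq]
    have h1 : |⟪u x, W x⟫| ≤ ‖u x‖ * (B * ‖u x‖) :=
      (abs_real_inner_le_norm _ _).trans (by gcongr; exact (hW x).trans (by gcongr; exact hgB x))
    have := hcE x hx
    rw [hK]
    nlinarith [neg_abs_le ⟪u x, W x⟫]
  have hFmono : MonotoneOn (fun x => F x + K * M x - c * x) (Set.Ici x₀) := by
    have hd : ∀ x, HasDerivAt (fun x => F x + K * M x - c * x)
        (⟪u x, W x - ζ • u x⟫ + ⟪v x, v x⟫ + K * ‖u x‖ ^ 2 - c) x := fun x =>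
      (((hF' x).add ((hM' x).const_mul K)).sub ((hasDerivAt_id x).const_mul c)).congr_deriv
        (by simp)
    refine monotoneOn_of_deriv_nonneg (convex_Ici x₀)
      (fun x _ => (hd x).continuousAt.continuousWithinAt)
      (fun x _ => (hd x).differentiableAt.differentiableWithinAt) fun x hx => ?_
    rw [interior_Ici] at hx
    rw [(hd x).deriv]
    linarith [hF_lower x (le_of_lt hx)]
  have hM_le : ∀ x ≥ x₀, M x ≤ ∫ t, ‖u t‖ ^ 2 := by
    intro x hx
    simp only [hM]
    rw [intervalIntegral.integral_of_le hx]
    exact setIntegral_le_integral hint (ae_of_all _ fun t => by positivity)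
  set d : ℝ := F x₀ - c * x₀ - K * ∫ t, ‖u t‖ ^ 2 with hd_def
  have hF_ge : ∀ x ≥ x₀, c * x + d ≤ F x := by
    intro x hx
    have h1 : F x₀ - c * x₀ ≤ F x + K * M x - c * x := by
      simpa [hM] using hFmono Set.self_mem_Ici hx hx
    have h2 := mul_le_mul_of_nonneg_left (hM_le x hx) hK0
    linarith
  set x₁ : ℝ := max x₀ ((1 - d) / c)
  have hF_one : ∀ x ≥ x₁, 1 ≤ F x := by
    intro x hx
    have hx1 : x₀ ≤ x := (le_max_left _ _).trans hx
    have hx2 : (1 - d) / c ≤ x := (le_max_right _ _).trans hx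
    rw [div_le_iff₀ hc] at hx2
    linarith [hF_ge x hx1]
  have hNmono : MonotoneOn (fun x => ‖u x‖ ^ 2 - 2 * x) (Set.Ici x₁) := by
    have hd : ∀ x, HasDerivAt (fun x => ‖u x‖ ^ 2 - 2 * x) (2 * F x - 2) x := fun x =>
      ((hu x).norm_sq.sub ((hasDerivAt_id x).const_mul 2)).congr_deriv (by simp [hF])
    refine monotoneOn_of_deriv_nonneg (convex_Ici x₁)
      (fun x _ => (hd x).continuousAt.continuousWithinAt)
      (fun x _ => (hd x).differentiableAt.differentiableWithinAt) fun x hx => ?_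
    rw [interior_Ici] at hx
    rw [(hd x).deriv]
    linarith [hF_one x (le_of_lt hx)]
  refine not_integrable_of_affine_le (x₁ := x₁) (b := -(2 * x₁)) two_pos (fun x hx => ?_) hint
  have h1 : ‖u x₁‖ ^ 2 - 2 * x₁ ≤ ‖u x‖ ^ 2 - 2 * x := hNmono Set.self_mem_Ici hx hx
  linarith [sq_nonneg ‖u x₁‖]

end AbstractSchrodinger

/-- The Euclidean operator norm of a `2 × 2` matrix is at most twice its largest entry. -/
theorem norm_toLp_mulVec_le {A : Matrix (Fin 2) (Fin 2) ℂ} {w : ℝ} (hA : ∀ i j, ‖A i j‖ ≤ w)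
    (z : Fin 2 → ℂ) : ‖WithLp.toLp 2 (A.mulVec z)‖ ≤ 2 * w * ‖WithLp.toLp 2 z‖ := by
  have hw : 0 ≤ w := (norm_nonneg _).trans (hA 0 0)
  have hrow : ∀ i, ‖A.mulVec z i‖ ≤ w * (‖z 0‖ + ‖z 1‖) := by
    intro i
    rw [Matrix.mulVec, dotProduct, Fin.sum_univ_two, mul_add]
    refine (norm_add_le _ _).trans ?_
    rw [norm_mul, norm_mul]
    gcongr <;> apply hA
  have hrow_sq : ∀ i, ‖A.mulVec z i‖ ^ 2 ≤ 2 * w ^ 2 * (‖z 0‖ ^ 2 + ‖z 1‖ ^ 2) := by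
    intro i
    have h1 := pow_le_pow_left₀ (norm_nonneg _) (hrow i) 2
    have h2 := mul_nonneg (sq_nonneg w) (sq_nonneg (‖z 0‖ - ‖z 1‖))
    nlinarith
  refine le_of_sq_le_sq ?_ (by positivity)
  rw [mul_pow, PiLp.norm_sq_eq_of_L2, PiLp.norm_sq_eq_of_L2, Fin.sum_univ_two, Fin.sum_univ_two]
  linarith [hrow_sq 0, hrow_sq 1]

/-- Absence of positive (embedded) eigenvalues for the matrix Schrödinger operator
`−d²/dx² + V` on the line, with `V` continuous, Hermitian-valued and decaying like
`(1+|x|)^{−β}`, `β > 1`: a square-integrable `C²` solution of `−u'' + Vu = ζu`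
with `ζ > 0` vanishes identically. -/
theorem no_positive_eigenvalues (V : ℝ → Matrix (Fin 2) (Fin 2) ℂ) (β C : ℝ)
    (hβ : 1 < β) (hC : 0 < C)
    (hVc : ∀ i j, Continuous fun x => V x i j)
    (hVh : ∀ x, (V x).IsHermitian)
    (hVb : ∀ x, ∀ i j, ‖V x i j‖ ≤ C * (1 + |x|) ^ (-β))
    (ζ : ℝ) (hζ : 0 < ζ)
    (u : ℝ → Fin 2 → ℂ) (hu : ContDiff ℝ 2 u)
    (hequ : ∀ x, -(deriv (deriv u) x) + (V x).mulVec (u x) = (ζ : ℂ) • u x)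
    (hint : Integrable fun x => ‖u x 0‖ ^ 2 + ‖u x 1‖ ^ 2) :
    ∀ x, u x = 0 := by
  set g : ℝ → ℝ := fun x => 2 * (C * (1 + |x|) ^ (-β)) with hg
  have hpos : ∀ x : ℝ, 0 < 1 + |x| := fun x => by positivity
  have hgc : Continuous g :=
    continuous_const.mul (continuous_const.mul
      ((continuous_const.add continuous_abs).rpow_const fun x => Or.inl (hpos x).ne'))
  have hg0 : ∀ x, 0 ≤ g x := fun x => by positivity
  have hgi : Integrable g := by
    have : Integrable fun x : ℝ => (1 + ‖x‖) ^ (-β) := integrable_one_add_norm (by simpa using hβ)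
    exact (this.const_mul C).const_mul 2
  have hgB : ∀ x, g x ≤ 2 * C := by
    intro x
    have : (1 + |x|) ^ (-β) ≤ 1 :=
      Real.rpow_le_one_of_one_le_of_nonpos (by linarith [abs_nonneg x]) (by linarith)
    simp only [hg]
    nlinarith
  have hu' : ContDiff ℝ 1 (deriv u) := hu.deriv'
  have hdu : ∀ x, HasDerivAt u (deriv u x) x := fun x =>
    ((hu.differentiable (by norm_num)) x).hasDerivAt
  have hddu : ∀ x, HasDerivAt (deriv u) (deriv (deriv u) x) x := fun x =>
    ((hu'.differentiable (by norm_num)) x).hasDerivAt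
  have hode : ∀ x, deriv (deriv u) x = (V x).mulVec (u x) - ζ • u x := by
    intro x
    have h : ζ • u x = (ζ : ℂ) • u x := by ext i; simp
    rw [h, ← hequ x]
    abel
  let L : (Fin 2 → ℂ) →L[ℝ] EuclideanSpace ℂ (Fin 2) :=
    (PiLp.continuousLinearEquiv 2 ℝ fun _ : Fin 2 => ℂ).symm
  intro x
  have hzero : L (u x) = 0 := by
    refine eq_zero_of_integrable_norm_sq (u := fun x => L (u x)) (v := fun x => L (deriv u x))
      (W := fun x => L ((V x).mulVec (u x))) hζ (fun x => L.hasFDerivAt.comp_hasDerivAt x (hdu x))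
      (fun x => ?_) (fun x => ?_) hgc hg0 hgi hgB ?_ x
    · refine (L.hasFDerivAt.comp_hasDerivAt x (hddu x)).congr_deriv ?_
      rw [hode, map_sub, map_smul]
    · exact norm_toLp_mulVec_le (hVb x) (u x)
    · refine hint.congr (ae_of_all _ fun x => ?_)
      simp only [EuclideanSpace.norm_sq_eq, Fin.sum_univ_two]
      rfl
  exact (PiLp.continuousLinearEquiv 2 ℝ fun _ : Fin 2 => ℂ).symm.map_eq_zero_iff.1 hzero
end
end
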